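/- arXiv:1111.5588 — 4 statements merged into one kernel-verified Lean document; each statement's English description precedes it below -/
import Mathlib

section
/- For all real numbers γ* > 0 and d_* > 0 there exists a constant C > 0 with the following property. Let Ω be a convex polygon with diam(Ω) ≤ 1 satisfying γ < γ* and |v_i − v_j| > d_*·diam(Ω) for all i ≠ j, let λ_1, …, λ_n be the mean value coordinates on Ω, and let u : ℝ² → ℝ be twice continuously differentiable on a neighborhood of Ω. Then the interpolant Iu(x) := Σ_{i=1}^n u(v_i) λ_i(x) satisfies ∫_Ω ((u − Iu)² + ‖∇(u − Iu)‖²) dx ≤ C² · diam(Ω)² · ∫_Ω ‖D²u(x)‖² dx, where ‖D²u(x)‖² is the sum of the squares of all second partial derivatives of u at x. -/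
open EuclideanGeometry Metric Real

noncomputable section

abbrev E2 := EuclideanSpace ℝ (Fin 2)

structure ConvexPolygon (n : ℕ) [NeZero n] where
  v : Fin n → E2
  hn : 3 ≤ n
  extreme : ∀ i, v i ∈ Set.extremePoints ℝ (convexHull ℝ (Set.range v))
  boundary : frontier (convexHull ℝ (Set.range v)) = ⋃ i, segment ℝ (v i) (v (i + 1))

namespace ConvexPolygon

variable {n : ℕ} [NeZero n] (P : ConvexPolygon n)

def region : Set E2 := convexHull ℝ (Set.range P.v)

def edge (i : Fin n) : Set E2 := segment ℝ (P.v i) (P.v (i + 1))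

def inradius : ℝ := sSup {r : ℝ | ∃ c : E2, Metric.closedBall c r ⊆ P.region}

def G1 (γs : ℝ) : Prop := Metric.diam P.region / P.inradius < γs

def G2 (ds : ℝ) : Prop := ∀ i j : Fin n, i ≠ j → ds < dist (P.v i) (P.v j)

def interiorAngle (i : Fin n) : ℝ := ∠ (P.v (i - 1)) (P.v i) (P.v (i + 1))

def angleAt (i : Fin n) (x : E2) : ℝ := ∠ (P.v i) x (P.v (i + 1))

def r (i : Fin n) (x : E2) : ℝ := dist x (P.v i)

def t (i : Fin n) (x : E2) : ℝ := Real.tan (P.angleAt i x / 2)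

def w (i : Fin n) (x : E2) : ℝ := (P.t (i - 1) x + P.t i x) / P.r i x

def lambda (i : Fin n) (x : E2) : ℝ := P.w i x / ∑ j, P.w j x

def nonadjacent (i j : Fin n) : Prop := i ≠ j ∧ i ≠ j + 1 ∧ j ≠ i + 1

def SepProp (h : ℝ) : Prop :=
  ∀ x ∈ P.region,
    (∀ i j k : Fin n, i ≠ j → j ≠ k → i ≠ k →
      ¬((Metric.closedBall x h ∩ P.edge i).Nonempty ∧
        (Metric.closedBall x h ∩ P.edge j).Nonempty ∧
        (Metric.closedBall x h ∩ P.edge k).Nonempty)) ∧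
    (∀ i j : Fin n, nonadjacent i j →
      ¬((Metric.closedBall x h ∩ P.edge i).Nonempty ∧
        (Metric.closedBall x h ∩ P.edge j).Nonempty))

end ConvexPolygon

/-- Frobenius norm squared of the second derivative: sum of squares of all second
partial derivatives. -/
def D2sq (u : E2 → ℝ) (x : E2) : ℝ :=
  ∑ i : Fin 2, ∑ j : Fin 2,
    (iteratedFDeriv ℝ 2 u x ![EuclideanSpace.single i (1:ℝ), EuclideanSpace.single j (1:ℝ)]) ^ 2

/-! ### Planar vector algebra -/

lemma nsq (a : E2) : ‖a‖ ^ 2 = a 0 ^ 2 + a 1 ^ 2 := by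
  rw [EuclideanSpace.real_norm_sq_eq, Fin.sum_univ_two]

lemma inn (a b : E2) : inner ℝ a b = a 0 * b 0 + a 1 * b 1 := by
  rw [PiLp.inner_apply, Fin.sum_univ_two]
  simp [mul_comm]

/-- Signed cross product (sign `σ`). -/
def X (σ : ℝ) (a b : E2) : ℝ := σ * (a 0 * b 1 - a 1 * b 0)

lemma X_sq {σ : ℝ} (hσ : σ ^ 2 = 1) (a b : E2) :
    X σ a b ^ 2 + (inner ℝ a b : ℝ) ^ 2 = ‖a‖ ^ 2 * ‖b‖ ^ 2 := by
  rw [nsq, nsq, inn, X, mul_pow, hσ]; ring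

lemma X_abs {σ : ℝ} (hσ : σ ^ 2 = 1) (a b : E2) : |X σ a b| ≤ ‖a‖ * ‖b‖ := by
  apply abs_le_of_sq_le_sq _ (by positivity)
  have := X_sq hσ a b
  nlinarith [sq_nonneg (inner ℝ a b : ℝ)]

lemma X_add_left (σ : ℝ) (a b c : E2) : X σ (a + b) c = X σ a c + X σ b c := by
  simp [X]; ring
lemma X_add_right (σ : ℝ) (a b c : E2) : X σ a (b + c) = X σ a b + X σ a c := by
  simp [X]; ring
lemma X_sub_left (σ : ℝ) (a b c : E2) : X σ (a - b) c = X σ a c - X σ b c := by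
  simp [X]; ring
lemma X_sub_right (σ : ℝ) (a b c : E2) : X σ a (b - c) = X σ a b - X σ a c := by
  simp [X]; ring
lemma X_smul_left (σ : ℝ) (s : ℝ) (a b : E2) : X σ (s • a) b = s * X σ a b := by
  simp [X]; ring
lemma X_smul_right (σ : ℝ) (s : ℝ) (a b : E2) : X σ a (s • b) = s * X σ a b := by
  simp [X]; ring
lemma X_self (σ : ℝ) (a : E2) : X σ a a = 0 := by
  simp [X]; ring_nf; simp
lemma X_swap (σ : ℝ) (a b : E2) : X σ a b = - X σ b a := by
  simp [X]; ring

lemma tan_half_formula (α : ℝ) : Real.tan (α / 2) = Real.sin α / (1 + Real.cos α) := by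
  have h : α = 2 * (α / 2) := by ring
  conv_rhs => rw [h]
  rw [Real.sin_two_mul, Real.cos_two_mul, Real.tan_eq_sin_div_cos]
  rcases eq_or_ne (Real.cos (α / 2)) 0 with h0 | h0
  · simp [h0]
  · field_simp; ring

lemma tan_half_angle {σ : ℝ} (hσ : σ ^ 2 = 1) (a b : E2) (h : 0 < X σ a b) :
    Real.tan (InnerProductGeometry.angle a b / 2)
      = X σ a b / (‖a‖ * ‖b‖ + inner ℝ a b) := by
  have hab : 0 < ‖a‖ * ‖b‖ := lt_of_lt_of_le h ((le_abs_self _).trans (X_abs hσ a b))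
  have hs : Real.sin (InnerProductGeometry.angle a b) * (‖a‖ * ‖b‖) = X σ a b := by
    rw [InnerProductGeometry.sin_angle_mul_norm_mul_norm]
    rw [real_inner_self_eq_norm_sq, real_inner_self_eq_norm_sq]
    rw [show ‖a‖ ^ 2 * ‖b‖ ^ 2 - inner ℝ a b * inner ℝ a b = X σ a b ^ 2 by
      have := X_sq hσ a b; linarith]
    exact Real.sqrt_sq h.le
  rw [tan_half_formula, InnerProductGeometry.cos_angle, ← hs]
  set A := ‖a‖ * ‖b‖
  field_simp

lemma Q_pos {σ : ℝ} (hσ : σ ^ 2 = 1) (a b : E2) (h : 0 < X σ a b) :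
    0 < ‖a‖ * ‖b‖ + inner ℝ a b := by
  have := X_sq hσ a b
  have h1 : |(inner ℝ a b : ℝ)| < ‖a‖ * ‖b‖ := by
    apply abs_lt_of_sq_lt_sq _ (by positivity)
    nlinarith
  linarith [(abs_lt.mp h1).1]

/-! Facts about pairs of unit vectors with half-angle tangent `t`. -/

section unit
variable {σ t : ℝ} {e f : E2}

lemma unit_c_gt (hσ : σ ^ 2 = 1) (he : ‖e‖ = 1) (hf : ‖f‖ = 1) (h : 0 < X σ e f) :
    0 < 1 + (inner ℝ e f : ℝ) := by
  have := Q_pos hσ e f h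
  rwa [he, hf, one_mul] at this

lemma unit_t (hσ : σ ^ 2 = 1) (he : ‖e‖ = 1) (hf : ‖f‖ = 1) (h : 0 < X σ e f)
    (ht : t = X σ e f / (1 + inner ℝ e f)) :
    0 < t ∧ t * (1 + inner ℝ e f) = X σ e f ∧ t * X σ e f = 1 - inner ℝ e f ∧
      t ^ 2 * (1 + inner ℝ e f) = 1 - inner ℝ e f ∧ (inner ℝ e f : ℝ) ≤ 1 := by
  have hc := unit_c_gt hσ he hf h
  have h2 := X_sq hσ e f
  rw [he, hf] at h2
  have h1 : t * (1 + inner ℝ e f) = X σ e f := by rw [ht]; field_simp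
  have h3 : t * X σ e f = 1 - inner ℝ e f := by
    have : (t * X σ e f) * (1 + inner ℝ e f) = (1 - inner ℝ e f) * (1 + inner ℝ e f) := by
      calc _ = (t * (1 + inner ℝ e f)) * X σ e f := by ring
        _ = _ := by rw [h1]; linarith
    exact mul_right_cancel₀ hc.ne' this
  have htp : 0 < t := by rw [ht]; positivity
  refine ⟨htp, h1, h3, ?_, ?_⟩
  · rw [← h3, ← h1]; ring
  · have : 0 < t * X σ e f := by positivity
    linarith

lemma unit_sub (hσ : σ ^ 2 = 1) (he : ‖e‖ = 1) (hf : ‖f‖ = 1) (h : 0 < X σ e f)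
    (ht : t = X σ e f / (1 + inner ℝ e f)) : ‖e - f‖ ≤ 2 * t := by
  obtain ⟨htp, -, -, h4, h5⟩ := unit_t hσ he hf h ht
  have hc := unit_c_gt hσ he hf h
  apply le_of_sq_le_sq _ (by positivity)
  rw [@norm_sub_sq_real, he, hf]
  nlinarith [sq_nonneg t]

lemma unit_add (hσ : σ ^ 2 = 1) (he : ‖e‖ = 1) (hf : ‖f‖ = 1) (h : 0 < X σ e f)
    (ht : t = X σ e f / (1 + inner ℝ e f)) : t * ‖e + f‖ ≤ 2 := by
  obtain ⟨htp, -, -, h4, h5⟩ := unit_t hσ he hf h ht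
  have hc := unit_c_gt hσ he hf h
  apply le_of_sq_le_sq _ (by positivity)
  rw [mul_pow, @norm_add_sq_real, he, hf]
  nlinarith [sq_nonneg t]

lemma unit_rot (hσ : σ ^ 2 = 1) (he : ‖e‖ = 1) (hf : ‖f‖ = 1) (h : 0 < X σ e f)
    (ht : t = X σ e f / (1 + inner ℝ e f)) :
    t * (e 0 + f 0) = σ * (f 1 - e 1) ∧ t * (e 1 + f 1) = σ * (e 0 - f 0) := by
  have hc := unit_c_gt hσ he hf h
  obtain ⟨htp, h1, -, -, -⟩ := unit_t hσ he hf h ht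
  have e1 := nsq e
  have f1 := nsq f
  rw [he] at e1
  rw [hf] at f1
  rw [inn] at hc h1
  rw [X] at h1
  constructor
  · apply mul_right_cancel₀ hc.ne'
    calc _ = (t * (1 + (e 0 * f 0 + e 1 * f 1))) * (e 0 + f 0) := by ring
      _ = _ := by
        rw [h1]; linear_combination (-σ * (f 1)) * e1 + (σ * e 1) * f1
  · apply mul_right_cancel₀ hc.ne'
    calc _ = (t * (1 + (e 0 * f 0 + e 1 * f 1))) * (e 1 + f 1) := by ring
      _ = _ := by
        rw [h1]; linear_combination (σ * (f 0)) * e1 - (σ * e 0) * f1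
end unit

/-! ### Geometry of the polygon -/

lemma sq_eq_one_iff_of_real {σ : ℝ} (hσ : σ ^ 2 = 1) : σ = 1 ∨ σ = -1 := by
  have : (σ - 1) * (σ + 1) = 0 := by linarith [hσ]
  rcases mul_eq_zero.mp this with h | h
  · left; linarith
  · right; linarith

lemma X_ball {σ : ℝ} (hσ : σ ^ 2 = 1) {r c : ℝ} (hr : 0 ≤ r) {u y p : E2}
    (h : ∀ z : E2, ‖z‖ ≤ r → c ≤ X σ u (y + z - p)) : c + r * ‖u‖ ≤ X σ u (y - p) := by
  rcases eq_or_ne u 0 with rfl | hu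
  · have := h 0 (by simpa using hr)
    simpa using this
  have hu' : 0 < ‖u‖ := norm_pos_iff.mpr hu
  let J : E2 := !₂[- u 1, u 0]
  have hJ : ‖J‖ = ‖u‖ := by
    have : ‖J‖ ^ 2 = ‖u‖ ^ 2 := by rw [nsq, nsq]; simp [J]; ring
    exact (sq_eq_sq₀ (norm_nonneg _) (norm_nonneg _)).mp this
  have h1 := h ((-(r * σ / ‖u‖)) • J) (by
    rw [norm_smul, hJ, norm_neg, norm_div, norm_norm, norm_mul, Real.norm_of_nonneg hr]
    have : ‖σ‖ = 1 := by
      rw [Real.norm_eq_abs]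
      rcases (sq_eq_one_iff_of_real hσ) with h | h
      all_goals simp [h]
    rw [this]; field_simp; exact le_rfl)
  have hXJ : X σ u J = σ * ‖u‖ ^ 2 := by
    rw [nsq]; simp only [X, J, Matrix.cons_val_zero, Matrix.cons_val_one, Matrix.cons_val_fin_one]; ring
  rw [show y + (-(r * σ / ‖u‖)) • J - p = (y - p) + (-(r * σ / ‖u‖)) • J by abel,
    X_add_right, X_smul_right, hXJ] at h1
  have : -(r * σ / ‖u‖) * (σ * ‖u‖ ^ 2) = - (r * ‖u‖) := by
    calc _ = -(r * σ ^ 2 * ‖u‖) := by field_simp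
      _ = _ := by rw [hσ]; ring
  linarith

structure Good {n : ℕ} [NeZero n] (P : ConvexPolygon n) (σ d δ γ ρ : ℝ) (o : E2) : Prop where
  hσ : σ ^ 2 = 1
  hd : 0 < d
  hδ : 0 < δ
  hγ : 0 < γ
  hρ0 : 0 < ρ
  hρ : d ≤ γ * ρ
  diam : ∀ y ∈ P.region, ∀ z ∈ P.region, ‖y - z‖ ≤ d
  ball : ∀ z : E2, ‖z‖ ≤ ρ → o + z ∈ P.region
  sep : ∀ i j, i ≠ j → δ * d ≤ ‖P.v i - P.v j‖
  supp : ∀ i, ∀ y ∈ P.region, 0 ≤ X σ (P.v (i + 1) - P.v i) (y - P.v i)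

lemma fin_one_ne {n : ℕ} [NeZero n] (hn : 3 ≤ n) (i : Fin n) : i + 1 ≠ i := by
  intro h
  have h1 : (1 : Fin n) = 0 := by simpa using h
  have h2 := congrArg Fin.val h1
  rw [Fin.coe_ofNat_eq_mod, Fin.val_zero, Nat.mod_eq_of_lt (by omega)] at h2
  omega

lemma fin_two_ne {n : ℕ} [NeZero n] (hn : 3 ≤ n) (i : Fin n) : i + 1 + 1 ≠ i := by
  intro h
  have h1 : (1 + 1 : Fin n) = 0 := by
    rw [add_assoc] at h; simpa using h
  have h2 := congrArg Fin.val h1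
  rw [Fin.val_add, Fin.coe_ofNat_eq_mod, Fin.val_zero, Nat.mod_eq_of_lt (by omega : 1 < n),
    Nat.mod_eq_of_lt (by omega)] at h2
  omega

lemma fin_succ_ind {n : ℕ} [NeZero n] {p : Fin n → Prop} (h0 : p 0) (h : ∀ i, p i → p (i + 1)) :
    ∀ i, p i := by
  have key : ∀ k : ℕ, p (Fin.ofNat n k) := by
    intro k
    induction k with
    | zero => simpa using h0
    | succ k ih =>
      have : Fin.ofNat n (k + 1) = Fin.ofNat n k + 1 := by
        ext; simp [Fin.val_add, Fin.ofNat]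
      rw [this]; exact h _ ih
  intro i
  have := key i.val
  simpa using this

namespace ConvexPolygon
variable {n : ℕ} [NeZero n] (P : ConvexPolygon n)

lemma v_mem (i : Fin n) : P.v i ∈ P.region := subset_convexHull _ _ ⟨i, rfl⟩

lemma region_convex : Convex ℝ P.region := convex_convexHull _ _

lemma region_compact : IsCompact P.region := (Set.finite_range P.v).isCompact_convexHull ℝ

lemma extreme_comb (i : Fin n) {y z : E2} (hy : y ∈ P.region) (hz : z ∈ P.region) {s : ℝ}
    (hs : 0 < s) (hs1 : s < 1) (h : P.v i = (1 - s) • y + s • z) : y = P.v i ∧ z = P.v i := by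
  have := P.extreme i
  rw [mem_extremePoints] at this
  exact this.2 y hy z hz ⟨1 - s, s, by linarith, hs, by ring, h.symm⟩

/-- A vertex is not a nonneg. combination of three other points of the region. -/
lemma extreme_tri (i : Fin n) {p q y : E2} (hp : p ∈ P.region) (hq : q ∈ P.region)
    (hy : y ∈ P.region) {a b c : ℝ} (ha : 0 ≤ a) (hb : 0 ≤ b) (hc : 0 ≤ c) (h1 : a + b + c = 1)
    (h : P.v i = a • p + b • q + c • y) : p = P.v i ∨ q = P.v i ∨ y = P.v i := by
  by_contra hcon
  push Not at hcon
  obtain ⟨h2, h3, h4⟩ := hcon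
  rcases eq_or_lt_of_le hc with hc0 | hc0
  · subst hc0
    rcases eq_or_lt_of_le hb with hb0 | hb0
    · subst hb0
      have : a = 1 := by linarith
      subst this
      apply h2; simp [h]
    · rcases eq_or_lt_of_le ha with ha0 | ha0
      · subst ha0
        have : b = 1 := by linarith
        subst this
        apply h3; simp [h]
      · exact h2 (P.extreme_comb i hp hq hb0 (by linarith) (by
          rw [h, show 1 - b = a by linarith]; simp)).1
  · rcases eq_or_lt_of_le (by linarith : c ≤ 1) with hc1 | hc1
    · have ha' : a = 0 := by linarith
      have hb' : b = 0 := by linarith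
      apply h4; simp [h, ha', hb', hc1]
    · have hw : (a / (1 - c)) • p + (b / (1 - c)) • q ∈ P.region :=
        P.region_convex hp hq (by apply div_nonneg <;> linarith) (by apply div_nonneg <;> linarith)
          (by rw [← add_div]; apply div_eq_one_iff_eq (by linarith) |>.mpr; linarith)
      have := P.extreme_comb i hw hy hc0 hc1 (by
        have h5 : (1 - c) ≠ 0 := by linarith
        rw [h, smul_add, smul_smul, smul_smul]
        congr 3 <;> field_simp)
      exact h4 this.2

lemma cross_ne (i j k : Fin n) (hij : P.v i ≠ P.v j) (hjk : P.v j ≠ P.v k) (hik : P.v i ≠ P.v k)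
    {σ : ℝ} (hσ : σ ^ 2 = 1) : X σ (P.v j - P.v i) (P.v k - P.v i) ≠ 0 := by
  intro h
  have hu : P.v j - P.v i ≠ 0 := sub_ne_zero.mpr hij.symm
  have hu' : 0 < ‖P.v j - P.v i‖ ^ 2 := by have := norm_pos_iff.mpr hu; positivity
  set u := P.v j - P.v i with hu_def
  set w := P.v k - P.v i with hw_def
  have hσ0 : σ ≠ 0 := by rintro rfl; norm_num at hσ
  have hcr : u 0 * w 1 - u 1 * w 0 = 0 := by
    rw [X] at h; exact (mul_eq_zero.mp h).resolve_left hσ0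
  set s : ℝ := inner ℝ u w / ‖u‖ ^ 2 with hs
  have hw : w = s • u := by
    ext m
    have h1 : s * ‖u‖ ^ 2 = inner ℝ u w := by rw [hs]; field_simp
    rw [nsq] at h1 hu'
    rw [inn] at h1
    apply mul_right_cancel₀ hu'.ne'
    rw [PiLp.smul_apply, smul_eq_mul]
    fin_cases m
    · simp only [Fin.zero_eta, Fin.isValue]
      linear_combination (-(u 0)) * h1 - u 1 * hcr
    · simp only [Fin.mk_one, Fin.isValue]
      linear_combination (-(u 1)) * h1 + u 0 * hcr
  have hk : P.v k = P.v i + s • (P.v j - P.v i) := by rw [← hu_def, ← hw, hw_def]; abel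
  rcases lt_trichotomy s 0 with h0 | h0 | h0
  · -- `v i` is between `v j` and `v k`
    have h1 : (1 - s) ≠ 0 := by linarith
    have := P.extreme_comb i (P.v_mem j) (P.v_mem k) (s := 1 / (1 - s))
      (by apply one_div_pos.mpr; linarith) (by rw [div_lt_one (by linarith)]; linarith) (by
        rw [hk]
        ext m
        simp only [PiLp.add_apply, PiLp.smul_apply, smul_eq_mul, PiLp.sub_apply]
        field_simp; ring)
    exact hij this.1.symm
  · apply hik; rw [hk, h0]; simp
  · rcases lt_trichotomy s 1 with h1 | h1 | h1
    · have := P.extreme_comb k (P.v_mem i) (P.v_mem j) h0 h1 (by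
        rw [hk]
        ext m
        simp only [PiLp.add_apply, PiLp.smul_apply, smul_eq_mul, PiLp.sub_apply]
        ring)
      exact hik this.1
    · apply hjk; rw [hk, h1]; simp
    · have := P.extreme_comb j (P.v_mem i) (P.v_mem k) (s := 1 / s)
        (by positivity) (by rw [div_lt_one h0]; exact h1) (by
        rw [hk]
        ext m
        simp only [PiLp.add_apply, PiLp.smul_apply, smul_eq_mul, PiLp.sub_apply]
        field_simp; ring)
      exact hij this.1

lemma exists_supp (hInt : (interior P.region).Nonempty) (i : Fin n) (hne : P.v (i + 1) ≠ P.v i) :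
    ∃ σ : ℝ, (σ = 1 ∨ σ = -1) ∧
      ∀ y ∈ P.region, 0 ≤ X σ (P.v (i + 1) - P.v i) (y - P.v i) := by
  set m : E2 := midpoint ℝ (P.v i) (P.v (i + 1)) with hm
  have hmf : m ∈ frontier P.region := by
    have : frontier P.region = ⋃ i, segment ℝ (P.v i) (P.v (i + 1)) := P.boundary
    rw [this]
    exact Set.mem_iUnion.mpr ⟨i, midpoint_mem_segment _ _⟩
  have hmi : m ∉ interior P.region := fun h => hmf.2 h
  obtain ⟨f, hf⟩ := geometric_hahn_banach_point_open P.region_convex.interior isOpen_interior hmi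
  have hf' : ∀ y ∈ P.region, f m ≤ f y := by
    intro y hy
    have hy' : y ∈ closure (interior P.region) := by
      rw [P.region_convex.closure_interior_eq_closure_of_nonempty_interior hInt]
      exact subset_closure hy
    exact closure_minimal (fun b hb => (hf b hb).le)
      (isClosed_le continuous_const f.continuous) hy'
  have hfm : f m = (f (P.v i) + f (P.v (i + 1))) / 2 := by
    rw [hm, midpoint_eq_smul_add, map_smul, map_add]; simp; ring
  have h1 := hf' _ (P.v_mem i)
  have h2 := hf' _ (P.v_mem (i + 1))
  have h3 : f (P.v i) = f m := by linarith
  have h4 : f (P.v (i + 1)) = f m := by linarith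
  set u := P.v (i + 1) - P.v i with hu
  have hfu : f u = 0 := by rw [hu, map_sub]; linarith
  have hu0 : 0 < ‖u‖ ^ 2 := by
    have := norm_pos_iff.mpr (sub_ne_zero.mpr hne); positivity
  set f0 := f (EuclideanSpace.single 0 1) with hf0
  set f1 := f (EuclideanSpace.single 1 1) with hf1
  have hrep : ∀ z : E2, f z = z 0 * f0 + z 1 * f1 := by
    intro z
    have : z = z 0 • EuclideanSpace.single 0 (1:ℝ) + z 1 • EuclideanSpace.single 1 (1:ℝ) := by
      ext m; fin_cases m <;> simp
    conv_lhs => rw [this]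
    rw [map_add, map_smul, map_smul]; simp [hf0, hf1]
  set μ : ℝ := (f1 * u 0 - f0 * u 1) with hμ
  have key : ∀ z : E2, f z * ‖u‖ ^ 2 = μ * (u 0 * z 1 - u 1 * z 0) := by
    intro z
    rw [hrep] at hfu
    rw [hrep, nsq, hμ]
    linear_combination (u 0 * z 0 + u 1 * z 1) * hfu
  obtain ⟨b, hb⟩ := hInt
  have hb' := hf b hb
  have hpos : ∀ y ∈ P.region, 0 ≤ μ * (u 0 * (y - P.v i) 1 - u 1 * (y - P.v i) 0) := by
    intro y hy
    rw [← key, map_sub]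
    have := hf' y hy
    apply mul_nonneg _ hu0.le
    linarith
  rcases lt_trichotomy μ 0 with h | h | h
  · refine ⟨-1, Or.inr rfl, fun y hy => ?_⟩
    have := hpos y hy
    rw [X]
    nlinarith
  · exfalso
    have := key (b - m)
    rw [h, zero_mul, map_sub] at this
    have : f b - f m = 0 := (mul_eq_zero.mp this).resolve_right hu0.ne'
    linarith
  · refine ⟨1, Or.inl rfl, fun y hy => ?_⟩
    have := hpos y hy
    rw [X]
    nlinarith

lemma exists_orient (hInt : (interior P.region).Nonempty) (hinj : Function.Injective P.v) :
    ∃ σ : ℝ, σ ^ 2 = 1 ∧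
      ∀ i, ∀ y ∈ P.region, 0 ≤ X σ (P.v (i + 1) - P.v i) (y - P.v i) := by
  have hne : ∀ i, P.v (i + 1) ≠ P.v i := fun i h => fin_one_ne P.hn i (hinj h)
  choose s hs1 hs2 using fun i => P.exists_supp hInt i (hne i)
  have hsq : ∀ i, s i ^ 2 = 1 := fun i => by rcases hs1 i with h | h <;> rw [h] <;> norm_num
  have hstep : ∀ i, s (i + 1) = s i := by
    intro i
    have a1 := hs2 i _ (P.v_mem (i + 1 + 1))
    have a2 := hs2 (i + 1) _ (P.v_mem i)
    have hc := P.cross_ne i (i + 1) (i + 1 + 1) (hne i).symm (hne (i + 1)).symm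
      (fun h => fin_two_ne P.hn i (hinj h).symm) (hsq i)
    have b1 := lt_of_le_of_ne a1 hc.symm
    rcases hs1 i with h | h <;> rcases hs1 (i + 1) with h' | h' <;> rw [h] at b1 <;>
      rw [h'] at a2 <;> rw [h, h'] <;> simp only [X, PiLp.sub_apply] at a2 b1 <;> exfalso <;>
      nlinarith
  have hall : ∀ i, s i = s 0 := fin_succ_ind rfl (fun i hi => by rw [hstep, hi])
  exact ⟨s 0, hsq 0, fun i y hy => by rw [← hall i]; exact hs2 i y hy⟩

lemma exists_good {γ δ : ℝ} (hγ : 0 < γ) (hδ : 0 < δ) (hInt : (interior P.region).Nonempty)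
    (h1 : Metric.diam P.region / P.inradius < γ)
    (h2 : ∀ i j : Fin n, i ≠ j → δ * Metric.diam P.region < dist (P.v i) (P.v j)) :
    ∃ σ ρ o, Good P σ (Metric.diam P.region) δ γ ρ o := by
  have hbd : Bornology.IsBounded P.region := P.region_compact.isBounded
  have hd0 : 0 ≤ Metric.diam P.region := Metric.diam_nonneg
  have hinj : Function.Injective P.v := by
    intro i j hij
    by_contra hne
    have := h2 i j hne
    rw [hij, dist_self] at this
    nlinarith
  have hd : 0 < Metric.diam P.region := by
    have h01 : P.v (0 + 1) ≠ P.v 0 := fun h => fin_one_ne P.hn 0 (hinj h)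
    have := Metric.dist_le_diam_of_mem hbd (P.v_mem (0 + 1)) (P.v_mem 0)
    have h3 := dist_pos.mpr h01
    linarith
  obtain ⟨σ, hσ, hsupp⟩ := P.exists_orient hInt hinj
  have hball : ∀ r c, Metric.closedBall c r ⊆ P.region → r ≤ Metric.diam P.region := by
    intro r c hc
    by_contra hlt
    push Not at hlt
    have hr : 0 < r := hd.trans hlt
    have hz : ‖(EuclideanSpace.single 0 r : E2)‖ = r := by simp [abs_of_pos hr]
    have := Metric.dist_le_diam_of_mem hbd (hc (Metric.mem_closedBall_self hr.le))
      (hc (a := c + EuclideanSpace.single 0 r) (by simp [abs_of_pos hr]))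
    rw [dist_self_add_right, hz] at this
    linarith
  have hbdd : BddAbove {r : ℝ | ∃ c : E2, Metric.closedBall c r ⊆ P.region} :=
    ⟨_, fun r ⟨c, hc⟩ => hball r c hc⟩
  have hinr : 0 < P.inradius := by
    obtain ⟨b, hb⟩ := hInt
    obtain ⟨ε, hε, hsub⟩ := Metric.isOpen_iff.mp isOpen_interior b hb
    have : ε / 2 ≤ P.inradius := le_csSup hbdd
      ⟨b, (Metric.closedBall_subset_ball (by linarith)).trans (hsub.trans interior_subset)⟩
    linarith
  have h3 : Metric.diam P.region / γ < P.inradius := by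
    rw [div_lt_iff₀ hinr] at h1
    rw [div_lt_iff₀ hγ]; linarith
  have hnon : {r : ℝ | ∃ c : E2, Metric.closedBall c r ⊆ P.region}.Nonempty :=
    ⟨-1, 0, by simp [Metric.closedBall_eq_empty.mpr (by norm_num : (-1:ℝ) < 0)]⟩
  obtain ⟨ρ, ⟨o, ho⟩, hρ⟩ := exists_lt_of_lt_csSup hnon h3
  refine ⟨σ, ρ, o, ⟨hσ, hd, hδ, hγ, lt_trans (by positivity) hρ, ?_, ?_, ?_, ?_, hsupp⟩⟩
  · rw [div_lt_iff₀ hγ] at hρ; linarith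
  · intro y hy z hz
    rw [← dist_eq_norm]; exact Metric.dist_le_diam_of_mem hbd hy hz
  · intro z hz
    apply ho; simpa using hz
  · intro i j hij
    rw [← dist_eq_norm]; exact (h2 i j hij).le

end ConvexPolygon

/-! ### Pointwise facts at an interior point -/

namespace ConvexPolygon
variable {n : ℕ} [NeZero n] (P : ConvexPolygon n)

/-- unit vector from `x` to `v i` -/
def ev (x : E2) (i : Fin n) : E2 := (P.r i x)⁻¹ • (P.v i - x)

lemma region_lower {σ c : ℝ} {u p : E2} (h : ∀ m, c ≤ X σ u (P.v m - p)) :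
    ∀ y ∈ P.region, c ≤ X σ u (y - p) := by
  have hconv : Convex ℝ {y : E2 | c ≤ X σ u (y - p)} := by
    intro y hy z hz a b ha hb hab
    simp only [Set.mem_ofPred_eq] at *
    have : X σ u (a • y + b • z - p) = a * X σ u (y - p) + b * X σ u (z - p) := by
      have hb' : b = 1 - a := by linarith
      subst hb'
      simp [X]; ring
    rw [this]
    have hb' : b = 1 - a := by linarith
    subst hb'
    nlinarith
  have := convexHull_min (s := Set.range P.v) (t := {y : E2 | c ≤ X σ u (y - p)})
    (by rintro _ ⟨m, rfl⟩; exact h m) hconv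
  exact fun y hy => this hy

end ConvexPolygon

namespace Good
variable {n : ℕ} [NeZero n] {P : ConvexPolygon n} {σ d δ γ ρ : ℝ} {o : E2}
  (G : Good P σ d δ γ ρ o)
include G

lemma edge_pos (i : Fin n) : δ * d ≤ ‖P.v (i + 1) - P.v i‖ := G.sep _ _ (fin_one_ne P.hn i)

lemma edge_pos' (i : Fin n) : 0 < ‖P.v (i + 1) - P.v i‖ :=
  lt_of_lt_of_le (mul_pos G.hδ G.hd) (G.edge_pos i)

lemma supp_o (i : Fin n) :
    ρ * ‖P.v (i + 1) - P.v i‖ ≤ X σ (P.v (i + 1) - P.v i) (o - P.v i) := by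
  have := X_ball G.hσ (r := ρ) (c := 0) G.hρ0.le (u := P.v (i + 1) - P.v i) (y := o) (p := P.v i)
    (fun z hz => G.supp i _ (G.ball z hz))
  linarith

lemma o_mem : o ∈ P.region := by simpa using G.ball 0 (by simpa using G.hρ0.le)

variable {x : E2} (hx : x ∈ interior P.region)
include hx

lemma strict (i : Fin n) : 0 < X σ (P.v (i + 1) - P.v i) (x - P.v i) := by
  obtain ⟨ε, hε, hsub⟩ := Metric.isOpen_iff.mp isOpen_interior x hx
  have := X_ball G.hσ (r := ε / 2) (c := 0) (by positivity) (u := P.v (i + 1) - P.v i) (y := x)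
    (p := P.v i) (fun z hz => G.supp i _ (interior_subset (hsub (by
      rw [Metric.mem_ball, dist_self_add_left]; linarith))))
  have h2 := G.edge_pos' i
  have : 0 < ε / 2 * ‖P.v (i + 1) - P.v i‖ := by positivity
  linarith

lemma X_pos (i : Fin n) : 0 < X σ (P.v i - x) (P.v (i + 1) - x) := by
  have := G.strict hx i
  have h2 : X σ (P.v (i + 1) - P.v i) (x - P.v i) = X σ (P.v i - x) (P.v (i + 1) - x) := by
    simp only [X, PiLp.sub_apply]; ring
  rwa [h2] at this

lemma r_pos (i : Fin n) : 0 < P.r i x := by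
  rw [ConvexPolygon.r, dist_pos]
  rintro rfl
  have := G.X_pos hx i
  simp [X] at this

lemma r_le (i : Fin n) : P.r i x ≤ d := by
  rw [ConvexPolygon.r, dist_eq_norm]
  exact G.diam _ (interior_subset hx) _ (P.v_mem i)

lemma r_eq (i : Fin n) : ‖P.v i - x‖ = P.r i x := by
  rw [ConvexPolygon.r, dist_eq_norm, norm_sub_rev]

lemma ev_norm (i : Fin n) : ‖P.ev x i‖ = 1 := by
  have := G.r_pos hx i
  rw [ConvexPolygon.ev, norm_smul, G.r_eq hx, norm_inv, Real.norm_of_nonneg this.le]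
  field_simp

lemma ev_smul (i : Fin n) : P.v i - x = P.r i x • P.ev x i := by
  have := G.r_pos hx i
  rw [ConvexPolygon.ev, smul_smul, mul_inv_cancel₀ this.ne', one_smul]

lemma Xe_pos (i : Fin n) : 0 < X σ (P.ev x i) (P.ev x (i + 1)) := by
  rw [ConvexPolygon.ev, ConvexPolygon.ev, X_smul_left, X_smul_right]
  have h1 := G.r_pos hx i
  have h2 := G.r_pos hx (i + 1)
  have h3 := G.X_pos hx i
  positivity

lemma t_formula (i : Fin n) : P.t i x =
    X σ (P.v i - x) (P.v (i + 1) - x) /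
      (‖P.v i - x‖ * ‖P.v (i + 1) - x‖ + inner ℝ (P.v i - x) (P.v (i + 1) - x)) := by
  rw [ConvexPolygon.t, ConvexPolygon.angleAt, EuclideanGeometry.angle]
  exact tan_half_angle G.hσ _ _ (G.X_pos hx i)

lemma t_ev (i : Fin n) : P.t i x =
    X σ (P.ev x i) (P.ev x (i + 1)) / (1 + inner ℝ (P.ev x i) (P.ev x (i + 1))) := by
  rw [G.t_formula hx, G.r_eq hx, G.r_eq hx, G.ev_smul hx, G.ev_smul hx (i + 1), X_smul_left,
    X_smul_right, inner_smul_left, inner_smul_right]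
  have h1 := G.r_pos hx i
  have h2 := G.r_pos hx (i + 1)
  simp only [conj_trivial]
  rw [← mul_assoc, ← mul_assoc, ← mul_one_add, mul_div_mul_left _ _ (by positivity)]

lemma t_pos (i : Fin n) : 0 < P.t i x :=
  (unit_t G.hσ (G.ev_norm hx i) (G.ev_norm hx (i + 1)) (G.Xe_pos hx i) (G.t_ev hx i)).1

lemma cone (k m : Fin n) (h1 : m ≠ k) (h2 : m ≠ k + 1) :
    X σ (P.ev x k) (P.ev x m) < 0 ∨ X σ (P.ev x m) (P.ev x (k + 1)) < 0 := by
  by_contra hcon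
  push Not at hcon
  obtain ⟨c1, c2⟩ := hcon
  have rk := G.r_pos hx k
  have rk1 := G.r_pos hx (k + 1)
  have rm := G.r_pos hx m
  have d1 : 0 ≤ X σ (P.v k - x) (P.v m - x) := by
    rw [G.ev_smul hx, G.ev_smul hx m, X_smul_left, X_smul_right]; positivity
  have d2 : 0 ≤ X σ (P.v m - x) (P.v (k + 1) - x) := by
    rw [G.ev_smul hx, G.ev_smul hx (k + 1), X_smul_left, X_smul_right]; positivity
  have hX := G.X_pos hx k
  have hs := G.supp k _ (P.v_mem m)
  set D := X σ (P.v k - x) (P.v (k + 1) - x) with hD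
  have hsum : X σ (P.v k - x) (P.v m - x) + X σ (P.v m - x) (P.v (k + 1) - x) ≤ D := by
    have : X σ (P.v (k + 1) - P.v k) (P.v m - P.v k) =
      D - (X σ (P.v k - x) (P.v m - x) + X σ (P.v m - x) (P.v (k + 1) - x)) := by
      rw [hD]; simp [X]; ring
    linarith
  have hxm : x ∈ P.region := interior_subset hx
  have := P.extreme_tri m (P.v_mem k) (P.v_mem (k + 1)) hxm
    (a := X σ (P.v m - x) (P.v (k + 1) - x) / D) (b := X σ (P.v k - x) (P.v m - x) / D)
    (c := 1 - (X σ (P.v m - x) (P.v (k + 1) - x) / D + X σ (P.v k - x) (P.v m - x) / D))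
    (by positivity) (by positivity)
    (by rw [← add_div, sub_nonneg, div_le_one hX]; linarith) (by ring) (by
      have key : D • (P.v m - x) = X σ (P.v m - x) (P.v (k + 1) - x) • (P.v k - x)
          + X σ (P.v k - x) (P.v m - x) • (P.v (k + 1) - x) := by
        ext q
        simp only [hD, X, PiLp.sub_apply, PiLp.smul_apply, PiLp.add_apply, smul_eq_mul]
        fin_cases q <;> simp <;> ring
      ext q
      have kq := congrArg (fun z : E2 => z q) key
      simp only [PiLp.sub_apply, PiLp.smul_apply, PiLp.add_apply, smul_eq_mul] at kq ⊢
      field_simp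
      linear_combination kq)
  have hne : ∀ i j : Fin n, i ≠ j → P.v i ≠ P.v j := by
    intro i j hij h
    have := G.sep i j hij
    rw [h, sub_self, norm_zero] at this
    have := mul_pos G.hδ G.hd
    linarith
  rcases this with h | h | h
  · exact hne _ _ h1 h.symm
  · exact hne _ _ h2 h.symm
  · subst h
    have := G.X_pos hx m
    rw [sub_self] at this; simp [X] at this

omit hx in
lemma strip {e : E2} (he : ‖e‖ = 1) {c : ℝ} (h : ∀ m, |X σ e (P.v m - x)| ≤ c) : ρ ≤ c := by
  have h1 := P.region_lower (σ := σ) (u := e) (p := x) (c := -c) (fun m => (abs_le.mp (h m)).1)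
  have h2 := P.region_lower (σ := σ) (u := -e) (p := x) (c := -c) (fun m => by
    have := (abs_le.mp (h m)).2
    rw [show X σ (-e) (P.v m - x) = - X σ e (P.v m - x) by simp [X]; ring]
    linarith)
  have b1 := X_ball G.hσ G.hρ0.le (u := e) (p := x) (y := o) (c := -c) (r := ρ)
    (fun z hz => h1 _ (G.ball z hz))
  have b2 := X_ball G.hσ G.hρ0.le (u := -e) (p := x) (y := o) (c := -c) (r := ρ)
    (fun z hz => h2 _ (G.ball z hz))
  rw [show X σ (-e) (o - x) = - X σ e (o - x) by simp [X]; ring, norm_neg] at b2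
  rw [he] at b1 b2
  linarith

/-- vertices lie almost on one side of a long-angle edge -/
lemma big_side {k : Fin n} {ε : ℝ} (hε : ‖P.ev x k + P.ev x (k + 1)‖ ≤ ε) (m : Fin n) :
    X σ (P.ev x k) (P.ev x m) ≤ ε := by
  have hε0 : 0 ≤ ε := (norm_nonneg _).trans hε
  have : X σ (P.ev x k) (P.ev x m) ≤ 0 ∨ X σ (P.ev x m) (P.ev x (k + 1)) ≤ 0 := by
    rcases eq_or_ne m k with rfl | h1
    · left; rw [X_self]
    rcases eq_or_ne m (k + 1) with rfl | h2
    · right; rw [X_self]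
    · rcases G.cone hx k m h1 h2 with h | h
      · exact Or.inl h.le
      · exact Or.inr h.le
  rcases this with h | h
  · linarith
  · have h2 := (le_abs_self _).trans (X_abs G.hσ (P.ev x k + P.ev x (k + 1)) (P.ev x m))
    rw [X_add_left, G.ev_norm hx m, mul_one] at h2
    rw [X_swap σ (P.ev x m)] at h
    linarith

lemma sum_small {k : Fin n} {B : ℝ} (hB : 0 < B) (hk : B < P.t k x) :
    ‖P.ev x k + P.ev x (k + 1)‖ ≤ 2 / B := by
  have h := unit_add G.hσ (G.ev_norm hx k) (G.ev_norm hx (k + 1)) (G.Xe_pos hx k) (G.t_ev hx k)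
  rw [le_div_iff₀ hB]
  nlinarith [norm_nonneg (P.ev x k + P.ev x (k + 1))]

lemma cos_neg {k : Fin n} (hk : 1 < P.t k x) :
    (inner ℝ (P.ev x k) (P.ev x (k + 1)) : ℝ) < 0 := by
  obtain ⟨-, -, -, h4, -⟩ :=
    unit_t G.hσ (G.ev_norm hx k) (G.ev_norm hx (k + 1)) (G.Xe_pos hx k) (G.t_ev hx k)
  have := unit_c_gt G.hσ (G.ev_norm hx k) (G.ev_norm hx (k + 1)) (G.Xe_pos hx k)
  nlinarith

lemma same_dir {k l : Fin n} (hkl : k ≠ l) (hk : 1 < P.t k x)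
    (hc : 0 < (inner ℝ (P.ev x k) (P.ev x l) : ℝ)) : X σ (P.ev x k) (P.ev x l) < 0 := by
  have hck := G.cos_neg hx hk
  have hl : l ≠ k + 1 := by rintro rfl; linarith
  rcases G.cone hx k l hkl.symm hl with h | h
  · exact h
  · by_contra hcon
    push Not at hcon
    have hp := G.Xe_pos hx k
    have h1 := nsq (P.ev x k)
    rw [G.ev_norm hx k] at h1
    have : X σ (P.ev x l) (P.ev x (k + 1)) =
        inner ℝ (P.ev x k) (P.ev x l) * X σ (P.ev x k) (P.ev x (k + 1))
        - X σ (P.ev x k) (P.ev x l) * inner ℝ (P.ev x k) (P.ev x (k + 1)) := by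
      rw [inn, inn, X, X, X]
      linear_combination (σ * (P.ev x l 0 * P.ev x (k + 1) 1 - P.ev x l 1 * P.ev x (k + 1) 0)) * h1
    nlinarith [mul_pos hc hp]

/-- F3: at most one half-angle tangent is large. -/
lemma F3 {B : ℝ} (hB1 : 1 ≤ B) (hB : 6 * γ < B) {k l : Fin n} (hkl : k ≠ l) :
    P.t k x ≤ B ∨ P.t l x ≤ B := by
  by_contra hcon
  push Not at hcon
  obtain ⟨hk, hl⟩ := hcon
  have hB0 : 0 < B := by linarith
  set ε := 2 / B with hε
  have hε0 : 0 < ε := by positivity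
  have ek := G.sum_small hx hB0 hk
  have el := G.sum_small hx hB0 hl
  have s1 := G.big_side hx ek
  have s2 := G.big_side hx el
  have hXX := X_sq G.hσ (P.ev x k) (P.ev x l)
  rw [G.ev_norm hx, G.ev_norm hx] at hXX
  have a1 := s1 l
  have a2 := s2 k
  rw [X_swap] at a2
  have habs : |X σ (P.ev x k) (P.ev x l)| ≤ ε := abs_le.mpr ⟨by linarith, a1⟩
  rcases lt_or_ge 0 (inner ℝ (P.ev x k) (P.ev x l) : ℝ) with hc | hc
  · have b1 := G.same_dir hx hkl (by linarith) hc
    have b2 := G.same_dir hx hkl.symm (k := l) (l := k) (by linarith) (by rwa [real_inner_comm])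
    rw [X_swap] at b2
    linarith
  · have hsq : X σ (P.ev x k) (P.ev x l) ^ 2 ≤ ε ^ 2 := sq_le_sq' (abs_le.mp habs).1 (abs_le.mp habs).2
    have hn : ‖P.ev x k + P.ev x l‖ ≤ 2 * ε := by
      apply le_of_sq_le_sq _ (by positivity)
      rw [@norm_add_sq_real, G.ev_norm hx, G.ev_norm hx]
      nlinarith
    have h3 : ∀ m, |X σ (P.ev x k) (P.ev x m)| ≤ 3 * ε := by
      intro m
      have h2 := (neg_abs_le _).trans' (neg_le_neg (X_abs G.hσ (P.ev x k + P.ev x l) (P.ev x m)))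
      rw [X_add_left, G.ev_norm hx m, mul_one] at h2
      rw [abs_le]
      constructor
      · linarith [s2 m]
      · linarith [s1 m]
    have := G.strip (x := x) (G.ev_norm hx k) (c := 3 * ε * d) (fun m => by
      rw [G.ev_smul hx m, X_smul_right, abs_mul, abs_of_pos (G.r_pos hx m)]
      have := h3 m
      have r1 := G.r_le hx m
      have r2 := G.r_pos hx m
      rw [mul_comm]
      apply mul_le_mul this r1 r2.le (by positivity))
    have hρ := G.hρ
    have : ρ ≤ 3 * ε * (γ * ρ) := this.trans (by gcongr)
    have hε3 : 3 * ε * γ < 1 := by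
      rw [hε]
      calc 3 * (2 / B) * γ = (6 * γ) / B := by ring
        _ < 1 := by rw [div_lt_one hB0]; exact hB
    have := G.hρ0
    nlinarith

/-- direction chords bounded by tangents -/
lemma ev_sub (k : Fin n) : ‖P.ev x k - P.ev x (k + 1)‖ ≤ 2 * P.t k x :=
  unit_sub G.hσ (G.ev_norm hx k) (G.ev_norm hx (k + 1)) (G.Xe_pos hx k) (G.t_ev hx k)

lemma w_pos (i : Fin n) : 0 < P.w i x := by
  rw [ConvexPolygon.w]
  have h1 := G.t_pos hx i
  have h2 := G.t_pos hx (i - 1)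
  have h3 := G.r_pos hx i
  positivity

lemma ev_sub_sum (j : Fin n) : ‖P.ev x 0 - P.ev x j‖ ≤ 2 * ∑ k, P.t k x := by
  have h := dist_le_range_sum_dist (fun k : ℕ => P.ev x (Fin.ofNat n k)) j.val
  have hj : Fin.ofNat n j.val = j := by simp
  have h0 : Fin.ofNat n 0 = (0 : Fin n) := by simp
  simp only [hj, h0, dist_eq_norm] at h
  refine h.trans ?_
  rw [Finset.mul_sum]
  have hsucc : ∀ k, Fin.ofNat n (k + 1) = Fin.ofNat n k + 1 := by
    intro k; ext; simp [Fin.val_add, Fin.ofNat]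
  calc _ ≤ ∑ k ∈ Finset.range j.val, 2 * P.t (Fin.ofNat n k) x := by
        apply Finset.sum_le_sum
        intro k _
        rw [hsucc]; exact G.ev_sub hx _
    _ ≤ ∑ k ∈ Finset.range n, 2 * P.t (Fin.ofNat n k) x := by
        apply Finset.sum_le_sum_of_subset_of_nonneg
        · exact Finset.range_subset_range.mpr j.2.le
        · intro k _ _
          have := G.t_pos hx (Fin.ofNat n k)
          positivity
    _ = _ := by
        rw [Finset.sum_range]
        apply Finset.sum_congr rfl
        intro k _
        simp

lemma sum_t : 1 / 2 ≤ ∑ k, P.t k x := by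
  have : ∃ j, (inner ℝ (P.ev x 0) (P.ev x j) : ℝ) ≤ 0 := by
    by_contra hcon
    push Not at hcon
    have hconv : Convex ℝ {y : E2 | 0 < (inner ℝ (P.ev x 0) (y - x) : ℝ)} := by
      intro y hy z hz a b ha hb hab
      simp only [Set.mem_ofPred_eq] at *
      have : (inner ℝ (P.ev x 0) (a • y + b • z - x) : ℝ)
          = a * inner ℝ (P.ev x 0) (y - x) + b * inner ℝ (P.ev x 0) (z - x) := by
        have hb' : b = 1 - a := by linarith
        subst hb'
        simp only [inner_sub_right, inner_add_right, inner_smul_right]; ring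
      rw [this]
      rcases eq_or_lt_of_le ha with h | h
      · have : b = 1 := by linarith
        rw [← h, this]; linarith
      · have := mul_pos h hy
        have := mul_nonneg hb hz.le
        linarith
    have := convexHull_min (s := Set.range P.v)
      (by
        rintro _ ⟨m, rfl⟩
        simp only [Set.mem_ofPred_eq]
        rw [G.ev_smul hx m, inner_smul_right]
        exact mul_pos (G.r_pos hx m) (hcon m)) hconv
    have h2 := this (interior_subset hx)
    simp at h2
  obtain ⟨j, hj⟩ := this
  have h := G.ev_sub_sum hx j
  have h2 : 2 ≤ ‖P.ev x 0 - P.ev x j‖ ^ 2 := by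
    rw [@norm_sub_sq_real, G.ev_norm hx, G.ev_norm hx]; linarith
  nlinarith [norm_nonneg (P.ev x 0 - P.ev x j)]

lemma W_eq : ∑ j, P.w j x = ∑ k, P.t k x * ((P.r k x)⁻¹ + (P.r (k + 1) x)⁻¹) := by
  simp only [ConvexPolygon.w, add_div, Finset.sum_add_distrib, mul_add, div_eq_mul_inv, add_mul]
  rw [add_comm]
  congr 1
  rw [← Equiv.sum_comp (Equiv.addRight (1 : Fin n))]
  simp

lemma W_ge_t (k : Fin n) : P.t k x * ((P.r k x)⁻¹ + (P.r (k + 1) x)⁻¹) ≤ ∑ j, P.w j x := by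
  rw [G.W_eq hx]
  apply Finset.single_le_sum (f := fun k => P.t k x * ((P.r k x)⁻¹ + (P.r (k + 1) x)⁻¹))
    _ (Finset.mem_univ k)
  intro i _
  have h1 := G.t_pos hx i
  have h2 := G.r_pos hx i
  have h3 := G.r_pos hx (i + 1)
  positivity

lemma inv_r (i : Fin n) : d⁻¹ ≤ (P.r i x)⁻¹ := inv_anti₀ (G.r_pos hx i) (G.r_le hx i)

lemma W_ge_t' (k : Fin n) : P.t k x * d⁻¹ ≤ ∑ j, P.w j x := by
  refine le_trans ?_ (G.W_ge_t hx k)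
  have h1 := G.inv_r hx k
  have h3 := G.r_pos hx (k + 1)
  apply mul_le_mul_of_nonneg_left _ (G.t_pos hx k).le
  have : 0 < (P.r (k + 1) x)⁻¹ := by positivity
  linarith

lemma W_ge : d⁻¹ ≤ ∑ j, P.w j x := by
  rw [G.W_eq hx]
  have h := G.sum_t hx
  have hd := G.hd
  calc d⁻¹ ≤ (∑ k, P.t k x) * (2 * d⁻¹) := by
        have : 0 < d⁻¹ := by positivity
        nlinarith
    _ ≤ _ := by
        rw [Finset.sum_mul]
        apply Finset.sum_le_sum
        intro k _
        apply mul_le_mul_of_nonneg_left _ (G.t_pos hx k).le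
        linarith [G.inv_r hx k, G.inv_r hx (k + 1)]

lemma w_le_W (i : Fin n) : P.w i x ≤ ∑ j, P.w j x :=
  Finset.single_le_sum (f := fun j => P.w j x) (fun j _ => (G.w_pos hx j).le) (Finset.mem_univ i)

end Good

namespace Good
variable {n : ℕ} [NeZero n] {P : ConvexPolygon n} {σ d δ γ ρ : ℝ} {o : E2}
  (G : Good P σ d δ γ ρ o)
include G

lemma delta_le : δ ≤ 1 := by
  have h1 := G.edge_pos 0
  have h2 := G.diam _ (P.v_mem (0 + 1)) _ (P.v_mem 0)
  have hd := G.hd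
  by_contra h
  push Not at h
  nlinarith

variable {x : E2} (hx : x ∈ interior P.region)
include hx

lemma F2 {i j : Fin n} (hij : i ≠ j) :
    (P.r i x)⁻¹ ≤ 2 / δ * d⁻¹ ∨ (P.r j x)⁻¹ ≤ 2 / δ * d⁻¹ := by
  have h := G.sep i j hij
  have h1 : ‖P.v i - P.v j‖ ≤ P.r i x + P.r j x := by
    have := dist_triangle_left (P.v i) (P.v j) x
    rw [← dist_eq_norm]; exact this
  have hp : 0 < δ / 2 * d := by have := G.hδ; have := G.hd; positivity
  have e : 2 / δ * d⁻¹ = (δ / 2 * d)⁻¹ := by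
    have := G.hδ; have := G.hd; field_simp
  rw [e]
  rcases le_or_gt (δ / 2 * d) (P.r i x) with h2 | h2
  · left; exact inv_anti₀ hp h2
  · right; apply inv_anti₀ hp; linarith

lemma near_vertex {i : Fin n} (hr : P.r i x ≤ δ * ρ / 4) :
    δ / (2 * γ) ≤ P.t (i - 1) x + P.t i x := by
  have hδ1 := G.delta_le
  have hδ := G.hδ
  have hd := G.hd
  have hρ0 := G.hρ0
  have hγ := G.hγ
  have hr0 := G.r_pos hx i
  have hox : ‖o - x‖ ≤ d := G.diam _ G.o_mem _ (interior_subset hx)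
  have hrx := G.r_eq hx i
  -- generic estimate
  have gen : ∀ L : E2, δ * d ≤ ‖L‖ → ‖L‖ ≤ d → ρ * ‖L‖ ≤ X σ L (o - P.v i) →
      ∀ s : ℝ, s ^ 2 = 1 →
      δ * d * ρ / 2 ≤ X σ L (o - P.v i) + X σ L (P.v i - x) + s * X σ (P.v i - x) (o - x) := by
    intro L h1 h2 h3 s hs
    have a1 := (abs_le.mp (X_abs G.hσ L (P.v i - x))).1
    have a2 := (X_abs G.hσ (P.v i - x) (o - x))
    rw [hrx] at a1 a2
    have a3 : - (P.r i x * d) ≤ s * X σ (P.v i - x) (o - x) := by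
      have : |s * X σ (P.v i - x) (o - x)| ≤ P.r i x * d := by
        rw [abs_mul]
        have : |s| = 1 := by rcases sq_eq_one_iff_of_real hs with h | h <;> simp [h]
        rw [this, one_mul]
        exact a2.trans (by gcongr)
      exact (abs_le.mp this).1
    have hrρ : P.r i x ≤ ρ := by nlinarith
    have : δ * d * (ρ - P.r i x) ≤ ‖L‖ * (ρ - P.r i x) :=
      mul_le_mul_of_nonneg_right h1 (by linarith)
    have : δ * d * P.r i x ≤ d * P.r i x := by
      have : δ * d ≤ 1 * d := by gcongr
      nlinarith
    have : d * P.r i x ≤ d * (δ * ρ / 4) := by gcongr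
    nlinarith
  have scale : ∀ j (s : ℝ), δ * d * ρ / 2 ≤ s * X σ (P.v j - x) (o - x) →
      δ * ρ / 2 ≤ s * X σ (P.ev x j) (o - x) := by
    intro j s h
    rw [G.ev_smul hx j, X_smul_left] at h
    have r1 := G.r_pos hx j
    have r2 := G.r_le hx j
    have hp : 0 < s * X σ (P.ev x j) (o - x) := by
      by_contra hcon
      push Not at hcon
      have : 0 < δ * d * ρ / 2 := by positivity
      nlinarith
    have : P.r j x * (s * X σ (P.ev x j) (o - x)) ≤ d * (s * X σ (P.ev x j) (o - x)) := by gcongr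
    have h' : d * (δ * ρ / 2) ≤ d * (s * X σ (P.ev x j) (o - x)) := by linarith
    exact le_of_mul_le_mul_left h' hd
  have b1 : δ * ρ / 2 ≤ 1 * X σ (P.ev x (i + 1)) (o - x) := by
    apply scale
    have := gen (P.v (i + 1) - P.v i) (G.edge_pos i)
      (G.diam _ (P.v_mem _) _ (P.v_mem _)) (G.supp_o i) 1 (by norm_num)
    refine this.trans (le_of_eq ?_)
    simp only [X, PiLp.sub_apply]; ring
  have hi : i - 1 + 1 = i := by simp
  have b2 : δ * ρ / 2 ≤ (-1) * X σ (P.ev x (i - 1)) (o - x) := by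
    apply scale
    have hs := G.supp_o (i - 1)
    have he := G.edge_pos (i - 1)
    rw [hi] at hs he
    have := gen (P.v i - P.v (i - 1)) he
      (G.diam _ (P.v_mem _) _ (P.v_mem _)) (hs.trans (le_of_eq (by
        simp only [X, PiLp.sub_apply]; ring))) (-1) (by norm_num)
    refine this.trans (le_of_eq ?_)
    simp only [X, PiLp.sub_apply]; ring
  have c1 := (le_abs_self _).trans (X_abs G.hσ (P.ev x (i + 1) - P.ev x (i - 1)) (o - x))
  rw [X_sub_left] at c1
  have c2 := G.ev_sub hx i
  have c3 := G.ev_sub hx (i - 1)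
  rw [hi] at c3
  have c4 : ‖P.ev x (i + 1) - P.ev x (i - 1)‖ ≤ 2 * (P.t (i - 1) x + P.t i x) := by
    have : P.ev x (i + 1) - P.ev x (i - 1)
      = -((P.ev x i - P.ev x (i + 1)) + (P.ev x (i - 1) - P.ev x i)) := by abel
    rw [this, norm_neg]
    refine (norm_add_le _ _).trans ?_
    linarith
  have t1 := G.t_pos hx i
  have t2 := G.t_pos hx (i - 1)
  set T := P.t (i - 1) x + P.t i x with hT
  have c5 : δ * ρ ≤ 2 * T * d := by
    calc δ * ρ ≤ ‖P.ev x (i + 1) - P.ev x (i - 1)‖ * ‖o - x‖ := by linarith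
      _ ≤ _ := by gcongr
  have c6 : δ * ρ ≤ 2 * T * (γ * ρ) := c5.trans (by
    apply mul_le_mul_of_nonneg_left G.hρ; linarith)
  rw [div_le_iff₀ (by positivity)]
  apply le_of_mul_le_mul_right _ hρ0
  linarith

lemma F4 {η : ℝ} (hη : η = δ / (4 * (2 + γ))) (i : Fin n) :
    (P.r i x)⁻¹ ≤ (1 / η + 2 * γ / δ) * ∑ j, P.w j x := by
  have hδ := G.hδ
  have hd := G.hd
  have hρ0 := G.hρ0
  have hγ := G.hγ
  have hr0 := G.r_pos hx i
  have hη0 : 0 < η := by rw [hη]; positivity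
  have hW := G.W_ge hx
  have hd' : 0 < d⁻¹ := by positivity
  rcases le_or_gt (η * d) (P.r i x) with h | h
  · have h1 : (P.r i x)⁻¹ ≤ (η * d)⁻¹ := inv_anti₀ (by positivity) h
    have h2 : (η * d)⁻¹ = 1 / η * d⁻¹ := by field_simp
    have h3 : 1 / η * d⁻¹ ≤ 1 / η * ∑ j, P.w j x := by gcongr
    have h4 : 0 ≤ 2 * γ / δ * ∑ j, P.w j x := mul_nonneg (by positivity) (by linarith)
    linarith
  · have h1 : P.r i x ≤ δ * ρ / 4 := by
      have : η * d ≤ η * (γ * ρ) := by have := G.hρ; gcongr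
      have h2 : η * (γ * ρ) ≤ δ * ρ / 4 := by
        rw [hη, div_mul_eq_mul_div, div_le_div_iff₀ (by positivity) (by positivity)]
        nlinarith [mul_pos hδ hρ0]
      linarith
    have h2 := G.near_vertex hx h1
    have h3 := G.w_le_W hx i
    rw [ConvexPolygon.w, div_eq_mul_inv] at h3
    set q := (P.r i x)⁻¹ with hq
    have hq0 : 0 < q := by positivity
    have h4 : δ / (2 * γ) * q ≤ ∑ j, P.w j x := le_trans (by gcongr) h3
    have h5 : q ≤ 2 * γ / δ * ∑ j, P.w j x := by
      calc q = 2 * γ / δ * (δ / (2 * γ) * q) := by field_simp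
        _ ≤ _ := by gcongr
    have : 0 ≤ 1 / η * ∑ j, P.w j x := mul_nonneg (by positivity) (by linarith)
    linarith

set_option maxHeartbeats 1600000 in
lemma F5a {η B : ℝ} (hη : η = δ / (4 * (2 + γ))) (hB1 : 1 ≤ B) (hB : 8 * γ / δ ^ 2 ≤ B)
    {i l : Fin n} (h1 : i ≠ l) (h2 : i ≠ l + 1) (hr : P.r i x < η * d) : P.t l x ≤ B := by
  by_contra ht
  push Not at ht
  have hδ := G.hδ
  have hd := G.hd
  have hρ0 := G.hρ0
  have hγ := G.hγ
  have hB0 : 0 < B := by linarith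
  have hη0 : 0 < η := by rw [hη]; positivity
  obtain ⟨htp, -, ht3, -, -⟩ :=
    unit_t G.hσ (G.ev_norm hx l) (G.ev_norm hx (l + 1)) (G.Xe_pos hx l) (G.t_ev hx l)
  have hc := G.cos_neg hx (k := l) (by linarith)
  have hc1 := unit_c_gt G.hσ (G.ev_norm hx l) (G.ev_norm hx (l + 1)) (G.Xe_pos hx l)
  have hXe0 := G.Xe_pos hx l
  have hXe : X σ (P.ev x l) (P.ev x (l + 1)) ≤ 2 / B := by
    rw [le_div_iff₀ hB0]; nlinarith
  set L := ‖P.v (l + 1) - P.v l‖ with hL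
  have hL0 : 0 < L := G.edge_pos' l
  have hLd : δ * d ≤ L := G.edge_pos l
  have hH := G.supp_o l
  set H := X σ (P.v (l + 1) - P.v l) (o - P.v l) with hHdef
  have hH0 : 0 < H := lt_of_lt_of_le (by positivity) hH
  have hS0 := G.supp l _ (P.v_mem i)
  set S := X σ (P.v (l + 1) - P.v l) (P.v i - P.v l) with hS
  have hrl := G.r_pos hx l
  have hrl1 := G.r_pos hx (l + 1)
  have hrl' := G.r_le hx l
  have hrl1' := G.r_le hx (l + 1)
  have hSle : S ≤ d * d * (2 / B) + L * (η * d) := by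
    have e1 : S = X σ (P.v l - x) (P.v (l + 1) - x) + X σ (P.v (l + 1) - P.v l) (P.v i - x) := by
      rw [hS]; simp only [X, PiLp.sub_apply]; ring
    have e2 := (le_abs_self _).trans (X_abs G.hσ (P.v (l + 1) - P.v l) (P.v i - x))
    rw [G.r_eq hx i, ← hL] at e2
    have e3 : X σ (P.v l - x) (P.v (l + 1) - x) ≤ d * d * (2 / B) := by
      rw [G.ev_smul hx l, G.ev_smul hx (l + 1), X_smul_left, X_smul_right, ← mul_assoc]
      gcongr
    have e4 : L * P.r i x ≤ L * (η * d) := by gcongr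
    linarith
  set g := S / H with hg
  have hg0 : 0 ≤ g := by positivity
  have hgle : g ≤ δ / 4 + γ * η := by
    rw [hg, div_le_iff₀ hH0]
    have f1 : d * d * (2 / B) ≤ L * ρ * (δ / 4) := by
      have : 2 / B ≤ δ ^ 2 / (4 * γ) := by
        rw [div_le_iff₀ (by positivity)] at hB
        rw [div_le_div_iff₀ hB0 (by positivity)]
        linarith
      calc d * d * (2 / B) ≤ d * (γ * ρ) * (δ ^ 2 / (4 * γ)) := by
            have := G.hρ; gcongr
        _ = (δ * d) * ρ * (δ / 4) := by field_simp
        _ ≤ _ := by gcongr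
    have f2 : L * (η * d) ≤ L * ρ * (γ * η) := by
      have := G.hρ
      calc L * (η * d) ≤ L * (η * (γ * ρ)) := by gcongr
        _ = _ := by ring
    have f3 : (δ / 4 + γ * η) * (ρ * L) ≤ (δ / 4 + γ * η) * H := by gcongr
    linarith
  set b := X σ (P.v i - P.v l) (o - P.v l) / H with hb
  have key : H • (P.v i - P.v l) = X σ (P.v i - P.v l) (o - P.v l) • (P.v (l + 1) - P.v l)
      + S • (o - P.v l) := by
    ext q
    simp only [hHdef, hS, X, PiLp.sub_apply, PiLp.smul_apply, PiLp.add_apply, smul_eq_mul]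
    fin_cases q <;> simp <;> ring
  have key2 : P.v i - P.v l = b • (P.v (l + 1) - P.v l) + g • (o - P.v l) := by
    have := congrArg (fun z : E2 => H⁻¹ • z) key
    simp only [smul_add, smul_smul] at this
    rw [inv_mul_cancel₀ hH0.ne', one_smul] at this
    rw [this, hb, hg, div_eq_inv_mul, div_eq_inv_mul]
  have hneg : b < 0 ∨ 1 - b - g < 0 := by
    by_contra hcon
    push Not at hcon
    have := P.extreme_tri i (P.v_mem l) (P.v_mem (l + 1)) G.o_mem hcon.2 hcon.1 hg0 (by ring) (by
      have : P.v i = P.v l + (P.v i - P.v l) := by abel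
      rw [this, key2]
      ext q
      simp only [PiLp.sub_apply, PiLp.smul_apply, PiLp.add_apply, smul_eq_mul]
      ring)
    have hne : ∀ i j : Fin n, i ≠ j → P.v i ≠ P.v j := by
      intro i j hij h
      have := G.sep i j hij
      rw [h, sub_self, norm_zero] at this
      have := mul_pos G.hδ G.hd
      linarith
    rcases this with h | h | h
    · exact hne _ _ h1 h.symm
    · exact hne _ _ h2 h.symm
    · have h3 := G.supp_o i
      rw [h, sub_self] at h3
      have h4 := G.edge_pos' i
      have h5 : X σ (P.v (i + 1) - P.v i) 0 = 0 := by simp [X]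
      rw [h5] at h3
      have : 0 < ρ * ‖P.v (i + 1) - P.v i‖ := by positivity
      linarith
  have fin : ∀ j : Fin n, i ≠ j → P.r j x - P.r i x ≤ g * d → False := by
    intro j hij hle
    have s1 := G.sep i j hij
    have s2 : ‖P.v i - P.v j‖ ≤ P.r i x + P.r j x := by
      have := dist_triangle_left (P.v i) (P.v j) x
      rw [← dist_eq_norm]; exact this
    have s3 : g * d ≤ (δ / 4 + γ * η) * d := by gcongr
    have s4 : (2 + γ) * η = δ / 4 := by rw [hη]; field_simp
    have s5 : 0 < δ * d := by positivity
    nlinarith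
  have ip : ∀ (j : Fin n), |(inner ℝ (P.v i - x) (P.ev x j) : ℝ)| ≤ P.r i x := by
    intro j
    have := abs_real_inner_le_norm (P.v i - x) (P.ev x j)
    rwa [G.ev_norm hx, G.r_eq hx, mul_one] at this
  have io : ∀ (j : Fin n), |(inner ℝ (o - P.v j) (P.ev x j) : ℝ)| ≤ d := by
    intro j
    have := abs_real_inner_le_norm (o - P.v j) (P.ev x j)
    rw [G.ev_norm hx, mul_one] at this
    exact this.trans (G.diam _ G.o_mem _ (P.v_mem j))
  have iself : ∀ j : Fin n, (inner ℝ (P.v j - x) (P.ev x j) : ℝ) = P.r j x := by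
    intro j
    rw [G.ev_smul hx, inner_smul_left, real_inner_self_eq_norm_sq, G.ev_norm hx]; simp
  rcases hneg with hn | hn
  · apply fin l h1
    have k1 := congrArg (fun z : E2 => (inner ℝ z (P.ev x l) : ℝ)) key2
    simp only [inner_add_left, inner_smul_left, conj_trivial] at k1
    have k2 : (inner ℝ (P.v i - P.v l) (P.ev x l) : ℝ)
        = inner ℝ (P.v i - x) (P.ev x l) - P.r l x := by
      rw [← iself l, ← inner_sub_left]; congr 1; abel
    have k3 : (inner ℝ (P.v (l + 1) - P.v l) (P.ev x l) : ℝ) < 0 := by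
      have : P.v (l + 1) - P.v l = (P.v (l + 1) - x) - (P.v l - x) := by abel
      rw [this, inner_sub_left, iself, G.ev_smul hx (l + 1), inner_smul_left, real_inner_comm]
      simp only [conj_trivial]
      nlinarith
    have k4 := (abs_le.mp (ip l)).2
    have k5 := (abs_le.mp (io l)).1
    have k6 : g * (-d) ≤ g * inner ℝ (o - P.v l) (P.ev x l) :=
      mul_le_mul_of_nonneg_left k5 hg0
    have k7 := mul_pos_of_neg_of_neg hn k3
    linarith
  · apply fin (l + 1) h2
    have key3 : P.v i - P.v (l + 1) = (1 - b - g) • (P.v l - P.v (l + 1)) + g • (o - P.v (l + 1)) := by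
      have : P.v i - P.v (l + 1) = (P.v i - P.v l) - (P.v (l + 1) - P.v l) := by abel
      rw [this, key2]
      ext q
      simp only [PiLp.sub_apply, PiLp.smul_apply, PiLp.add_apply, smul_eq_mul]
      ring
    have k1 := congrArg (fun z : E2 => (inner ℝ z (P.ev x (l + 1)) : ℝ)) key3
    simp only [inner_add_left, inner_smul_left, conj_trivial] at k1
    have k2 : (inner ℝ (P.v i - P.v (l + 1)) (P.ev x (l + 1)) : ℝ)
        = inner ℝ (P.v i - x) (P.ev x (l + 1)) - P.r (l + 1) x := by
      rw [← iself (l + 1), ← inner_sub_left]; congr 1; abel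
    have k3 : (inner ℝ (P.v l - P.v (l + 1)) (P.ev x (l + 1)) : ℝ) < 0 := by
      have : P.v l - P.v (l + 1) = (P.v l - x) - (P.v (l + 1) - x) := by abel
      rw [this, inner_sub_left, iself, G.ev_smul hx l, inner_smul_left]
      simp only [conj_trivial]
      nlinarith
    have k4 := (abs_le.mp (ip (l + 1))).2
    have k5 := (abs_le.mp (io (l + 1))).1
    have k6 : g * (-d) ≤ g * inner ℝ (o - P.v (l + 1)) (P.ev x (l + 1)) :=
      mul_le_mul_of_nonneg_left k5 hg0
    have k7 := mul_pos_of_neg_of_neg hn k3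
    linarith

lemma F5 {η B : ℝ} (hη : η = δ / (4 * (2 + γ))) (hB1 : 1 ≤ B) (hB : 8 * γ / δ ^ 2 ≤ B)
    (i l : Fin n) : P.t l x * (P.r i x)⁻¹ ≤
      (1 + 1 / η + B * (1 / η + 2 * γ / δ)) * ∑ j, P.w j x := by
  have hδ := G.hδ
  have hd := G.hd
  have hρ0 := G.hρ0
  have hγ := G.hγ
  have hr0 := G.r_pos hx i
  have hη0 : 0 < η := by rw [hη]; positivity
  have hW := G.W_ge hx
  have hd' : 0 < d⁻¹ := by positivity
  have ht := G.t_pos hx l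
  set W := ∑ j, P.w j x with hWdef
  have hW0 : 0 < W := by linarith
  have q1 : 0 ≤ 1 / η * W := by positivity
  have q2 : 0 ≤ B * (1 / η + 2 * γ / δ) * W := by positivity
  have hsplit : (1 + 1 / η + B * (1 / η + 2 * γ / δ)) * W
    = W + 1 / η * W + B * (1 / η + 2 * γ / δ) * W := by ring
  rw [hsplit]
  rcases le_or_gt (η * d) (P.r i x) with h | h
  · have h1 : (P.r i x)⁻¹ ≤ (η * d)⁻¹ := inv_anti₀ (by positivity) h
    have h2 : (η * d)⁻¹ = 1 / η * d⁻¹ := by field_simp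
    have h3 := G.W_ge_t' hx l
    have : P.t l x * (P.r i x)⁻¹ ≤ 1 / η * W := by
      calc _ ≤ P.t l x * (1 / η * d⁻¹) := by rw [← h2]; gcongr
        _ = 1 / η * (P.t l x * d⁻¹) := by ring
        _ ≤ _ := by gcongr
    linarith
  · by_cases h1 : i = l
    · have h3 := G.W_ge_t hx l
      have : 0 < P.t l x * (P.r (l + 1) x)⁻¹ := mul_pos ht (inv_pos.mpr (G.r_pos hx _))
      rw [mul_add] at h3
      rw [h1]; linarith
    by_cases h2 : i = l + 1
    · have h3 := G.W_ge_t hx l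
      have : 0 < P.t l x * (P.r l x)⁻¹ := mul_pos ht (inv_pos.mpr (G.r_pos hx _))
      rw [mul_add] at h3
      rw [h2]; linarith
    have h3 := G.F5a hx hη hB1 hB h1 h2 h
    have h4 := G.F4 hx hη i
    have : P.t l x * (P.r i x)⁻¹ ≤ B * ((1 / η + 2 * γ / δ) * W) := by gcongr
    linarith

end Good

namespace ConvexPolygon
variable {n : ℕ} [NeZero n] (P : ConvexPolygon n)

lemma r_sqrt (i : Fin n) (x : E2) :
    P.r i x = √((P.v i 0 - x 0) ^ 2 + (P.v i 1 - x 1) ^ 2) := by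
  rw [r, dist_comm, EuclideanSpace.dist_eq, Fin.sum_univ_two, Real.dist_eq, Real.dist_eq,
    sq_abs, sq_abs]

lemma hasD_r (i : Fin n) (x z : E2) (h : 0 < P.r i x) :
    HasDerivAt (fun s : ℝ => P.r i (x + s • z)) (-(inner ℝ (P.v i - x) z) * (P.r i x)⁻¹) 0 := by
  simp only [r_sqrt, PiLp.add_apply, PiLp.smul_apply, smul_eq_mul]
  rw [r_sqrt] at h
  have h1 : ∀ q : Fin 2, HasDerivAt (fun s : ℝ => P.v i q - (x q + s * z q)) (-(z q)) 0 := by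
    intro q
    have := (((hasDerivAt_id (0:ℝ)).mul_const (z q)).const_add (x q)).const_sub (P.v i q)
    simpa using this
  have h2 := ((((h1 0).pow 2).add ((h1 1).pow 2)).sqrt (by
    simpa using (Real.sqrt_pos.mp h).ne'))
  refine (h2.congr_deriv ?_).congr_of_eventuallyEq ?_
  · rw [inn]
    simp only [Pi.add_apply, Pi.pow_apply, PiLp.sub_apply, zero_mul, add_zero]
    field_simp
    push_cast
    ring
  · exact Filter.Eventually.of_forall fun s => by simp

lemma hasD_q (i : Fin n) (x z : E2) (h : 0 < P.r i x) :
    HasDerivAt (fun s : ℝ => (P.r i (x + s • z))⁻¹)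
      ((inner ℝ (P.v i - x) z) * (P.r i x)⁻¹ ^ 3) 0 := by
  have := (P.hasD_r i x z h).inv (by simpa using h.ne')
  refine this.congr_deriv ?_
  simp only [zero_smul, add_zero]
  field_simp

lemma ev_coord (i : Fin n) (x : E2) (q : Fin 2) :
    P.ev x i q = (P.r i x)⁻¹ * (P.v i q - x q) := by
  simp [ev]

/-- angular velocity of the unit vector pointing to the `i`-th vertex -/
def om (i : Fin n) (x z : E2) : ℝ :=
  -((P.v i - x) 0 * z 1 - (P.v i - x) 1 * z 0) * (P.r i x)⁻¹ ^ 2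

lemma hasD_e (i : Fin n) (x z : E2) (h : 0 < P.r i x) :
    HasDerivAt (fun s : ℝ => P.ev (x + s • z) i 0) (-P.om i x z * P.ev x i 1) 0 ∧
    HasDerivAt (fun s : ℝ => P.ev (x + s • z) i 1) (P.om i x z * P.ev x i 0) 0 := by
  have h1 : ∀ q : Fin 2, HasDerivAt (fun s : ℝ => P.v i q - (x q + s * z q)) (-(z q)) 0 := by
    intro q
    have := (((hasDerivAt_id (0:ℝ)).mul_const (z q)).const_add (x q)).const_sub (P.v i q)
    simpa using this
  have hr : (P.r i x)⁻¹ ^ 2 * ((P.v i 0 - x 0) ^ 2 + (P.v i 1 - x 1) ^ 2) = 1 := by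
    have : P.r i x ^ 2 = (P.v i 0 - x 0) ^ 2 + (P.v i 1 - x 1) ^ 2 := by
      rw [r_sqrt, Real.sq_sqrt (by positivity)]
    rw [← this]; field_simp
  simp only [ev_coord, PiLp.add_apply, PiLp.smul_apply, smul_eq_mul]
  constructor
  · refine ((P.hasD_q i x z h).mul (h1 0)).congr_deriv ?_
    simp only [zero_smul, add_zero, zero_mul, om, inn, PiLp.sub_apply]
    linear_combination (P.r i x)⁻¹ * z 0 * hr
  · refine ((P.hasD_q i x z h).mul (h1 1)).congr_deriv ?_
    simp only [zero_smul, add_zero, zero_mul, om, inn, PiLp.sub_apply]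
    linear_combination (P.r i x)⁻¹ * z 1 * hr

lemma om_le (i : Fin n) (x z : E2) (h : 0 < P.r i x) : |P.om i x z| ≤ (P.r i x)⁻¹ * ‖z‖ := by
  have h1 := X_abs (σ := 1) (by norm_num) (P.v i - x) z
  have h2 : ‖P.v i - x‖ = P.r i x := by rw [r, dist_comm, dist_eq_norm]
  rw [X, one_mul, h2] at h1
  rw [om, abs_mul, abs_neg, abs_of_nonneg (by positivity : 0 ≤ (P.r i x)⁻¹ ^ 2)]
  calc _ ≤ P.r i x * ‖z‖ * (P.r i x)⁻¹ ^ 2 := by gcongr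
    _ = _ := by field_simp

lemma dq_le (i : Fin n) (x z : E2) (h : 0 < P.r i x) :
    |(inner ℝ (P.v i - x) z) * (P.r i x)⁻¹ ^ 3| ≤ (P.r i x)⁻¹ ^ 2 * ‖z‖ := by
  have h1 := abs_real_inner_le_norm (P.v i - x) z
  have h2 : ‖P.v i - x‖ = P.r i x := by rw [r, dist_comm, dist_eq_norm]
  rw [h2] at h1
  rw [abs_mul, abs_of_nonneg (by positivity : 0 ≤ (P.r i x)⁻¹ ^ 3)]
  calc _ ≤ P.r i x * ‖z‖ * (P.r i x)⁻¹ ^ 3 := by gcongr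
    _ = _ := by field_simp

end ConvexPolygon

namespace Good
variable {n : ℕ} [NeZero n] {P : ConvexPolygon n} {σ d δ γ ρ : ℝ} {o : E2}
  (G : Good P σ d δ γ ρ o) {x : E2} (hx : x ∈ interior P.region)
include G hx

omit G in
lemma line_mem (z : E2) : ∀ᶠ s : ℝ in nhds 0, x + s • z ∈ interior P.region := by
  have hc : ContinuousAt (fun s : ℝ => x + s • z) 0 := by fun_prop
  apply hc.eventually_mem
  simpa using isOpen_interior.mem_nhds hx

lemma hasD_t (k : Fin n) (z : E2) : ∃ D, HasDerivAt (fun s : ℝ => P.t k (x + s • z)) D 0 ∧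
    |D| ≤ (1 + P.t k x ^ 2) * ((P.r k x)⁻¹ + (P.r (k + 1) x)⁻¹) * ‖z‖ := by
  obtain ⟨a0, a1⟩ := P.hasD_e k x z (G.r_pos hx k)
  obtain ⟨b0, b1⟩ := P.hasD_e (k + 1) x z (G.r_pos hx (k + 1))
  obtain ⟨htp, h1, -, h3, -⟩ :=
    unit_t G.hσ (G.ev_norm hx k) (G.ev_norm hx (k + 1)) (G.Xe_pos hx k) (G.t_ev hx k)
  have hc := unit_c_gt G.hσ (G.ev_norm hx k) (G.ev_norm hx (k + 1)) (G.Xe_pos hx k)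
  have e1 := nsq (P.ev x k)
  have f1 := nsq (P.ev x (k + 1))
  rw [G.ev_norm hx] at e1 f1
  rw [inn] at hc h3
  have o1 := P.om_le k x z (G.r_pos hx k)
  have o2 := P.om_le (k + 1) x z (G.r_pos hx (k + 1))
  have hnum := ((a0.mul b1).sub (a1.mul b0)).const_mul σ
  have hden := ((a0.mul b0).add (a1.mul b1)).const_add 1
  have hq := hnum.div hden (by simpa using hc.ne')
  simp only [zero_smul, add_zero, Pi.mul_apply, Pi.sub_apply, Pi.add_apply] at hq
  have hs : |σ| = 1 := by
    have := G.hσ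
    rw [← sq_abs] at this
    nlinarith [abs_nonneg σ]
  refine ⟨σ * (P.om (k + 1) x z - P.om k x z) * ((1 + P.t k x ^ 2) / 2), ?_, ?_⟩
  · refine (hq.congr_deriv ?_).congr_of_eventuallyEq ?_
    · generalize P.ev x k = e at *
      generalize P.ev x (k + 1) = f at *
      have e2 : (1 + P.t k x ^ 2) / 2 = 1 / (1 + (e 0 * f 0 + e 1 * f 1)) := by
        rw [eq_div_iff hc.ne']; linarith
      rw [e2, mul_one_div]
      rw [div_eq_div_iff (by positivity) hc.ne']
      linear_combination σ * (P.om (k + 1) x z - P.om k x z) *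
        (1 + (e 0 * f 0 + e 1 * f 1)) * (-(f 0 ^ 2 + f 1 ^ 2) * e1 - f1)
    · filter_upwards [line_mem hx z] with s hs
      rw [G.t_ev hs, X, inn]
      rfl
  · rw [abs_mul, abs_mul, hs, one_mul, abs_of_nonneg (by positivity : 0 ≤ (1 + P.t k x ^ 2) / 2)]
    have := abs_sub (P.om (k + 1) x z) (P.om k x z)
    have h0 : 0 ≤ (P.r k x)⁻¹ * ‖z‖ := (abs_nonneg _).trans o1
    have h0' : 0 ≤ (P.r (k + 1) x)⁻¹ * ‖z‖ := (abs_nonneg _).trans o2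
    calc _ ≤ ((P.r (k + 1) x)⁻¹ * ‖z‖ + (P.r k x)⁻¹ * ‖z‖) * ((1 + P.t k x ^ 2) / 2) := by
          gcongr; linarith
      _ ≤ ((P.r (k + 1) x)⁻¹ * ‖z‖ + (P.r k x)⁻¹ * ‖z‖) * (1 + P.t k x ^ 2) := by
          gcongr; nlinarith
      _ = _ := by ring

lemma diff_q (i : Fin n) : DifferentiableAt ℝ (fun y => (P.r i y)⁻¹) x := by
  have h := G.r_pos hx i
  have h2 : DifferentiableAt ℝ (fun y => P.r i y) x := by
    simp only [ConvexPolygon.r, dist_eq_norm]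
    refine DifferentiableAt.norm ℝ (by fun_prop) ?_
    rw [ConvexPolygon.r, dist_eq_norm, norm_pos_iff] at h
    exact h
  exact h2.inv h.ne'

lemma diff_t (i : Fin n) : DifferentiableAt ℝ (fun y => P.t i y) x := by
  have h1 := G.X_pos hx i
  have hQ := Q_pos G.hσ _ _ h1
  have n1 : P.v i - x ≠ 0 := by
    intro h; rw [h] at h1; simp [X] at h1
  have n2 : P.v (i + 1) - x ≠ 0 := by
    intro h; rw [h] at h1; simp [X] at h1
  have : DifferentiableAt ℝ (fun y : E2 => X σ (P.v i - y) (P.v (i + 1) - y) /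
      (‖P.v i - y‖ * ‖P.v (i + 1) - y‖ + inner ℝ (P.v i - y) (P.v (i + 1) - y))) x := by
    simp only [div_eq_mul_inv]
    refine DifferentiableAt.mul ?_ (DifferentiableAt.fun_inv ?_ hQ.ne')
    · simp only [X, PiLp.sub_apply]; fun_prop
    · refine DifferentiableAt.add (DifferentiableAt.mul ?_ ?_) ?_
      · exact DifferentiableAt.norm ℝ (by fun_prop) n1
      · exact DifferentiableAt.norm ℝ (by fun_prop) n2
      · exact DifferentiableAt.inner ℝ (by fun_prop) (by fun_prop)
  refine this.congr_of_eventuallyEq ?_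
  filter_upwards [isOpen_interior.mem_nhds hx] with y hy using G.t_formula hy i

lemma diff_w (i : Fin n) : DifferentiableAt ℝ (fun y => P.w i y) x := by
  simp only [ConvexPolygon.w, div_eq_mul_inv]
  exact ((G.diff_t hx _).add (G.diff_t hx _)).mul (G.diff_q hx i)

lemma diff_lambda (i : Fin n) : DifferentiableAt ℝ (fun y => P.lambda i y) x := by
  simp only [ConvexPolygon.lambda, div_eq_mul_inv]
  have h1 := G.W_ge hx
  have := G.hd
  have h2 : 0 < d⁻¹ := by positivity
  have h3 : DifferentiableAt ℝ (fun y => ∑ j, P.w j y) x :=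
    DifferentiableAt.fun_sum fun j _ => G.diff_w hx j
  have h4 : (fun y => ∑ j, P.w j y) x ≠ 0 := ne_of_gt (lt_of_lt_of_le h2 h1)
  exact (G.diff_w hx i).mul (h3.fun_inv h4)

omit G hx in
lemma fderiv_line {f : E2 → ℝ} (hf : DifferentiableAt ℝ f x) {z : E2} {D : ℝ}
    (h : HasDerivAt (fun s : ℝ => f (x + s • z)) D 0) : fderiv ℝ f x z = D := by
  have h1 : HasDerivAt (fun s : ℝ => x + s • z) z 0 := by
    simpa using ((hasDerivAt_id (0:ℝ)).smul_const z).const_add x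
  have h2 : HasFDerivAt f (fderiv ℝ f x) (x + (0:ℝ) • z) := by simpa using hf.hasFDerivAt
  exact (h2.comp_hasDerivAt 0 h1).unique h

end Good

lemma T1_bound {A κ W C5 tk tl qi qj : ℝ} (hA : 0 ≤ A) (hκ : 0 ≤ κ) (hW : 0 ≤ W) (hC5 : 0 ≤ C5)
    (htk : 0 ≤ tk) (htl : 0 ≤ tl) (hqi : 0 ≤ qi) (hqj : 0 ≤ qj)
    (h2 : qi ≤ A * κ ∨ qj ≤ A * κ) (h5 : tk * qi ≤ C5 * W) (h5' : tl * qi ≤ C5 * W)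
    (h5'' : tl * qj ≤ C5 * W) : tk * tl * qj * qi ^ 2 ≤ A * C5 ^ 2 * (κ * W ^ 2) := by
  rcases h2 with h2 | h2
  · calc tk * tl * qj * qi ^ 2 = (tk * qi) * (tl * qj) * qi := by ring
      _ ≤ (C5 * W) * (C5 * W) * (A * κ) := by gcongr
      _ = _ := by ring
  · calc tk * tl * qj * qi ^ 2 = (tk * qi) * (tl * qi) * qj := by ring
      _ ≤ (C5 * W) * (C5 * W) * (A * κ) := by gcongr
      _ = _ := by ring

lemma T2_aux {B W C4 C5 tk tl q M : ℝ} (hB : 0 ≤ B) (hW : 0 ≤ W) (hC4 : 0 ≤ C4) (hC5 : 0 ≤ C5)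
    (htk : 0 ≤ tk) (htl : 0 ≤ tl) (hq : 0 ≤ q) (hM : 0 ≤ M)
    (h3 : tk ≤ B ∨ tl ≤ B) (h5 : tk * q ≤ C5 * W) (h5' : tl * q ≤ C5 * W)
    (hM1 : M ≤ 2 * C4 * W) (hM2 : tk * M ≤ W) :
    q * tl * (1 + tk ^ 2) * M ≤ (2 * C4 * C5 * (1 + B ^ 2) + B * C5) * W ^ 2 := by
  rcases h3 with h3 | h3
  · calc q * tl * (1 + tk ^ 2) * M = (tl * q) * (1 + tk ^ 2) * M := by ring
      _ ≤ (C5 * W) * (1 + B ^ 2) * (2 * C4 * W) := by gcongr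
      _ ≤ (C5 * W) * (1 + B ^ 2) * (2 * C4 * W) + B * C5 * W ^ 2 :=
          le_add_of_nonneg_right (by positivity)
      _ = _ := by ring
  · calc q * tl * (1 + tk ^ 2) * M = (tl * q) * M + tl * ((tk * q) * (tk * M)) := by ring
      _ ≤ (C5 * W) * (2 * C4 * W) + B * ((C5 * W) * W) := by gcongr
      _ ≤ (C5 * W) * (2 * C4 * W) + B * ((C5 * W) * W) + 2 * C4 * C5 * B ^ 2 * W ^ 2 :=
          le_add_of_nonneg_right (by positivity)
      _ = _ := by ring

lemma T2_bound {A κ B W C4 C5 tk tl qi qj M : ℝ} (hA : 0 ≤ A) (hκ : 0 ≤ κ) (hB : 0 ≤ B)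
    (hW : 0 ≤ W) (hC4 : 0 ≤ C4) (hC5 : 0 ≤ C5)
    (htk : 0 ≤ tk) (htl : 0 ≤ tl) (hqi : 0 ≤ qi) (hqj : 0 ≤ qj) (hM : 0 ≤ M)
    (h2 : qi ≤ A * κ ∨ qj ≤ A * κ)
    (h3 : tk ≤ B ∨ tl ≤ B) (h5i : tk * qi ≤ C5 * W) (h5i' : tl * qi ≤ C5 * W)
    (h5j : tk * qj ≤ C5 * W) (h5j' : tl * qj ≤ C5 * W)
    (hM1 : M ≤ 2 * C4 * W) (hM2 : tk * M ≤ W) :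
    qi * qj * (tl * ((1 + tk ^ 2) * M)) ≤
      A * (2 * C4 * C5 * (1 + B ^ 2) + B * C5) * (κ * W ^ 2) := by
  rcases h2 with h2 | h2
  · have := T2_aux hB hW hC4 hC5 htk htl hqj hM h3 h5j h5j' hM1 hM2
    calc _ = qi * (qj * tl * (1 + tk ^ 2) * M) := by ring
      _ ≤ (A * κ) * ((2 * C4 * C5 * (1 + B ^ 2) + B * C5) * W ^ 2) := by gcongr
      _ = _ := by ring
  · have := T2_aux hB hW hC4 hC5 htk htl hqi hM h3 h5i h5i' hM1 hM2
    calc _ = qj * (qi * tl * (1 + tk ^ 2) * M) := by ring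
      _ ≤ (A * κ) * ((2 * C4 * C5 * (1 + B ^ 2) + B * C5) * W ^ 2) := by gcongr
      _ = _ := by ring

/-- abstract bound for the derivative of the quotient `w_i / ∑ w_j` -/
lemma abstract_bound {n : ℕ} [NeZero n] {A κ B W C4 C5 Z : ℝ} {t q dt dq : Fin n → ℝ}
    (hA : 0 ≤ A) (hκ : 0 ≤ κ) (hB : 0 ≤ B) (hW : 0 ≤ W) (hC4 : 0 ≤ C4) (hC5 : 0 ≤ C5) (hZ : 0 ≤ Z)
    (ht : ∀ k, 0 ≤ t k) (hq : ∀ i, 0 ≤ q i)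
    (h2 : ∀ i j, i ≠ j → q i ≤ A * κ ∨ q j ≤ A * κ)
    (h3 : ∀ k l, k ≠ l → t k ≤ B ∨ t l ≤ B)
    (h4 : ∀ i, q i ≤ C4 * W) (h5 : ∀ l i, t l * q i ≤ C5 * W)
    (hWt : ∀ k, t k * (q k + q (k + 1)) ≤ W)
    (hdq : ∀ i, |dq i| ≤ q i ^ 2 * Z)
    (hdt : ∀ k, |dt k| ≤ (1 + t k ^ 2) * (q k + q (k + 1)) * Z)
    {i j : Fin n} (hij : i ≠ j) (k l : Fin n) :
    |q i * q j * (t l * dt k - t k * dt l) + t k * t l * (q j * dq i - q i * dq j)| ≤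
      2 * A * (2 * C4 * C5 * (1 + B ^ 2) + B * C5 + C5 ^ 2) * (κ * W ^ 2) * Z := by
  have hqi := hq i
  have hqj := hq j
  have htk := ht k
  have htl := ht l
  have M1 : ∀ k, q k + q (k + 1) ≤ 2 * C4 * W := fun k => by linarith [h4 k, h4 (k + 1)]
  have M0 : ∀ k, 0 ≤ q k + q (k + 1) := fun k => by linarith [hq k, hq (k + 1)]
  have p1 : |t k * t l * (q j * dq i - q i * dq j)| ≤ 2 * (A * C5 ^ 2 * (κ * W ^ 2)) * Z := by
    have a1 := T1_bound hA hκ hW hC5 htk htl hqi hqj (h2 i j hij) (h5 k i) (h5 l i) (h5 l j)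
    have a2 := T1_bound hA hκ hW hC5 htk htl hqj hqi (h2 i j hij).symm (h5 k j) (h5 l j) (h5 l i)
    rw [abs_mul, abs_of_nonneg (by positivity : 0 ≤ t k * t l)]
    calc _ ≤ t k * t l * (|q j * dq i| + |q i * dq j|) := by gcongr; exact abs_sub _ _
      _ = t k * t l * (q j * |dq i| + q i * |dq j|) := by
          rw [abs_mul, abs_mul, abs_of_nonneg hqi, abs_of_nonneg hqj]
      _ ≤ t k * t l * (q j * (q i ^ 2 * Z) + q i * (q j ^ 2 * Z)) := by
          gcongr
          · exact hdq i
          · exact hdq j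
      _ = (t k * t l * q j * q i ^ 2 + t k * t l * q i * q j ^ 2) * Z := by ring
      _ ≤ _ := by gcongr; linarith
  have p2 : |q i * q j * (t l * dt k - t k * dt l)| ≤
      2 * (A * (2 * C4 * C5 * (1 + B ^ 2) + B * C5) * (κ * W ^ 2)) * Z := by
    by_cases hkl : k = l
    · rw [hkl, sub_self, mul_zero, abs_zero]; positivity
    have a1 := T2_bound hA hκ hB hW hC4 hC5 htk htl hqi hqj (M0 k) (h2 i j hij) (h3 k l hkl)
      (h5 k i) (h5 l i) (h5 k j) (h5 l j) (M1 k) (hWt k)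
    have a2 := T2_bound hA hκ hB hW hC4 hC5 htl htk hqi hqj (M0 l) (h2 i j hij) (h3 k l hkl).symm
      (h5 l i) (h5 k i) (h5 l j) (h5 k j) (M1 l) (hWt l)
    rw [abs_mul, abs_of_nonneg (by positivity : 0 ≤ q i * q j)]
    calc _ ≤ q i * q j * (|t l * dt k| + |t k * dt l|) := by gcongr; exact abs_sub _ _
      _ = q i * q j * (t l * |dt k| + t k * |dt l|) := by
          rw [abs_mul, abs_mul, abs_of_nonneg htk, abs_of_nonneg htl]
      _ ≤ q i * q j * (t l * ((1 + t k ^ 2) * (q k + q (k + 1)) * Z)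
            + t k * ((1 + t l ^ 2) * (q l + q (l + 1)) * Z)) := by
          gcongr
          · exact hdt k
          · exact hdt l
      _ = (q i * q j * (t l * ((1 + t k ^ 2) * (q k + q (k + 1))))
            + q i * q j * (t k * ((1 + t l ^ 2) * (q l + q (l + 1))))) * Z := by ring
      _ ≤ _ := by gcongr; linarith
  calc _ ≤ _ := abs_add_le _ _
    _ ≤ _ := add_le_add p2 p1
    _ = _ := by ring

/-- the gradient constant -/
def Cgrad (γ δ : ℝ) : ℝ :=
  let η := δ / (4 * (2 + γ))
  let B := 1 + 6 * γ + 8 * γ / δ ^ 2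
  let C4 := 1 / η + 2 * γ / δ
  let C5 := 1 + 1 / η + B * C4
  8 * (2 / δ) * (2 * C4 * C5 * (1 + B ^ 2) + B * C5 + C5 ^ 2)

namespace Good
variable {n : ℕ} [NeZero n] {P : ConvexPolygon n} {σ d δ γ ρ : ℝ} {o : E2}
  (G : Good P σ d δ γ ρ o) {x : E2} (hx : x ∈ interior P.region)
include G hx

lemma grad_lambda (i : Fin n) (z : E2) :
    |fderiv ℝ (fun y => P.lambda i y) x z| ≤ n * (Cgrad γ δ * d⁻¹) * ‖z‖ := by
  choose dt hdt hdt' using fun k => G.hasD_t hx k z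
  set dq : Fin n → ℝ := fun i => (inner ℝ (P.v i - x) z) * (P.r i x)⁻¹ ^ 3 with hdqdef
  have hdq : ∀ i, HasDerivAt (fun s : ℝ => (P.r i (x + s • z))⁻¹) (dq i) 0 :=
    fun i => P.hasD_q i x z (G.r_pos hx i)
  have hdq' : ∀ i, |dq i| ≤ (P.r i x)⁻¹ ^ 2 * ‖z‖ := fun i => P.dq_le i x z (G.r_pos hx i)
  set t : Fin n → ℝ := fun k => P.t k x with htdef
  set q : Fin n → ℝ := fun k => (P.r k x)⁻¹ with hqdef
  have hw : ∀ i, P.w i x = (t (i - 1) + t i) * q i := fun i => by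
    rw [ConvexPolygon.w, div_eq_mul_inv]
  set dw : Fin n → ℝ := fun i => (dt (i - 1) + dt i) * q i + (t (i - 1) + t i) * dq i with hdw
  have hDw : ∀ i, HasDerivAt (fun s : ℝ => P.w i (x + s • z)) (dw i) 0 := by
    intro i
    have := ((hdt (i - 1)).add (hdt i)).mul (hdq i)
    simp only [ConvexPolygon.w, div_eq_mul_inv]
    refine this.congr_deriv ?_
    simp [hdw, htdef, hqdef]
  have hδ := G.hδ
  have hd := G.hd
  have hγ := G.hγ
  have hd' : 0 < d⁻¹ := by positivity
  set W := ∑ j, P.w j x with hWdef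
  have hW : 0 < W := lt_of_lt_of_le hd' (G.W_ge hx)
  have hDW : HasDerivAt (fun s : ℝ => ∑ j, P.w j (x + s • z)) (∑ j, dw j) 0 :=
    HasDerivAt.fun_sum fun j _ => hDw j
  have hDl := (hDw i).div hDW (by simpa using hW.ne')
  simp only [zero_smul, add_zero] at hDl
  rw [fderiv_line (G.diff_lambda hx i) hDl]
  rw [← hWdef]
  have hη0 : 0 < δ / (4 * (2 + γ)) := by positivity
  set η := δ / (4 * (2 + γ)) with hη
  set B := 1 + 6 * γ + 8 * γ / δ ^ 2 with hB
  have hB8 : 0 < 8 * γ / δ ^ 2 := by positivity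
  have hB1 : 1 ≤ B := by linarith
  set C4 := 1 / η + 2 * γ / δ with hC4
  have hC40 : 0 ≤ C4 := by positivity
  set C5 := 1 + 1 / η + B * C4 with hC5
  have hC50 : 0 ≤ C5 := by positivity
  have key : ∀ j, |dw i * P.w j x - P.w i x * dw j| ≤ Cgrad γ δ * d⁻¹ * ‖z‖ * W ^ 2 := by
    intro j
    have hC : Cgrad γ δ = 8 * (2 / δ) * (2 * C4 * C5 * (1 + B ^ 2) + B * C5 + C5 ^ 2) := rfl
    by_cases hij : i = j
    · rw [hij, mul_comm, sub_self, abs_zero, hC]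
      positivity
    have ab := fun k l => abstract_bound (A := 2 / δ) (κ := d⁻¹) (B := B) (W := W) (C4 := C4)
      (C5 := C5) (Z := ‖z‖) (t := t) (q := q) (dt := dt) (dq := dq) (by positivity) hd'.le
      (by linarith) hW.le hC40 hC50 (norm_nonneg _)
      (fun k => (G.t_pos hx k).le) (fun k => (inv_pos.mpr (G.r_pos hx k)).le)
      (fun i j hij => G.F2 hx hij) (fun k l hkl => G.F3 hx hB1 (by linarith) hkl)
      (fun i => G.F4 hx hη i) (fun l i => G.F5 hx hη hB1 (by linarith) i l)
      (fun k => G.W_ge_t hx k) hdq' hdt' hij k l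
    rw [hw, hw]
    have e : dw i * ((t (j - 1) + t j) * q j) - (t (i - 1) + t i) * q i * dw j =
        (q i * q j * (t (j-1) * dt (i-1) - t (i-1) * dt (j-1))
          + t (i-1) * t (j-1) * (q j * dq i - q i * dq j)) +
        (q i * q j * (t j * dt (i-1) - t (i-1) * dt j)
          + t (i-1) * t j * (q j * dq i - q i * dq j)) +
        (q i * q j * (t (j-1) * dt i - t i * dt (j-1))
          + t i * t (j-1) * (q j * dq i - q i * dq j)) +
        (q i * q j * (t j * dt i - t i * dt j)
          + t i * t j * (q j * dq i - q i * dq j)) := by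
      simp only [hdw]; ring
    rw [e, hC]
    have b1 := ab (i - 1) (j - 1)
    have b2 := ab (i - 1) j
    have b3 := ab i (j - 1)
    have b4 := ab i j
    refine (abs_add_le _ _).trans ((add_le_add ((abs_add_le _ _).trans
      (add_le_add ((abs_add_le _ _).trans (add_le_add b1 b2)) b3)) b4).trans (le_of_eq ?_))
    ring
  rw [abs_div, abs_of_nonneg (by positivity : 0 ≤ W ^ 2), div_le_iff₀ (by positivity)]
  have e2 : dw i * W - P.w i x * ∑ j, dw j = ∑ j, (dw i * P.w j x - P.w i x * dw j) := by
    rw [hWdef, Finset.mul_sum, Finset.mul_sum, Finset.sum_sub_distrib]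
  rw [e2]
  calc _ ≤ ∑ j, |dw i * P.w j x - P.w i x * dw j| := Finset.abs_sum_le_sum_abs _ _
    _ ≤ ∑ j : Fin n, Cgrad γ δ * d⁻¹ * ‖z‖ * W ^ 2 := Finset.sum_le_sum fun j _ => key j
    _ = _ := by rw [Finset.sum_const, Finset.card_univ, Fintype.card_fin, nsmul_eq_mul]; ring

lemma lambda_nonneg (i : Fin n) : 0 ≤ P.lambda i x :=
  div_nonneg (G.w_pos hx i).le (Finset.sum_nonneg fun j _ => (G.w_pos hx j).le)

lemma lambda_le_one (i : Fin n) : P.lambda i x ≤ 1 :=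
  div_le_one_of_le₀ (G.w_le_W hx i) (Finset.sum_nonneg fun j _ => (G.w_pos hx j).le)

lemma sum_lambda : ∑ i, P.lambda i x = 1 := by
  have hd := G.hd
  have hd' : 0 < d⁻¹ := by positivity
  have hW := lt_of_lt_of_le hd' (G.W_ge hx)
  simp only [ConvexPolygon.lambda]
  rw [← Finset.sum_div, div_self hW.ne']

lemma linear_prec : ∑ i, P.lambda i x • (P.v i - x) = 0 := by
  have h1 : ∑ i, P.w i x • (P.v i - x) = ∑ k, P.t k x • (P.ev x k + P.ev x (k + 1)) := by
    have : ∀ i, P.w i x • (P.v i - x) = P.t (i - 1) x • P.ev x i + P.t i x • P.ev x i := by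
      intro i
      rw [G.ev_smul hx, smul_smul, ← add_smul, ConvexPolygon.w,
        div_mul_cancel₀ _ (G.r_pos hx i).ne']
    simp only [this, smul_add, Finset.sum_add_distrib]
    rw [add_comm]
    congr 1
    rw [← Equiv.sum_comp (Equiv.addRight (1 : Fin n))]
    simp
  have shift : ∀ f : Fin n → ℝ, ∑ k, f (k + 1) = ∑ k, f k := fun f => by
    rw [← Equiv.sum_comp (Equiv.addRight (1 : Fin n)) f]; rfl
  have h2 : ∑ k, P.t k x • (P.ev x k + P.ev x (k + 1)) = 0 := by
    have rot := fun k => unit_rot G.hσ (G.ev_norm hx k) (G.ev_norm hx (k + 1)) (G.Xe_pos hx k)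
      (G.t_ev hx k)
    ext q
    rw [WithLp.ofLp_sum, Finset.sum_apply]
    simp only [PiLp.smul_apply, PiLp.add_apply, smul_eq_mul, PiLp.zero_apply]
    fin_cases q
    · simp only [Fin.zero_eta, (rot _).1]
      rw [← Finset.mul_sum, Finset.sum_sub_distrib, shift (fun k => P.ev x k 1), sub_self, mul_zero]
    · simp only [Fin.mk_one, (rot _).2]
      rw [← Finset.mul_sum, Finset.sum_sub_distrib, shift (fun k => P.ev x k 0), sub_self, mul_zero]
  have h3 : ∀ i, P.lambda i x • (P.v i - x) = (∑ j, P.w j x)⁻¹ • P.w i x • (P.v i - x) := by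
    intro i
    rw [smul_smul, ConvexPolygon.lambda, div_eq_inv_mul]
  simp only [h3]
  rw [← Finset.smul_sum, h1, h2, smul_zero]

lemma sum_dlambda (z : E2) : ∑ i, fderiv ℝ (fun y => P.lambda i y) x z = 0 := by
  have h1 : HasFDerivAt (fun y => ∑ i, P.lambda i y)
      (∑ i, fderiv ℝ (fun y => P.lambda i y) x) x :=
    HasFDerivAt.fun_sum fun i _ => (G.diff_lambda hx i).hasFDerivAt
  have h2 : HasFDerivAt (fun y => ∑ i, P.lambda i y) (0 : E2 →L[ℝ] ℝ) x := by
    refine (hasFDerivAt_const (1:ℝ) x).congr_of_eventuallyEq ?_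
    filter_upwards [isOpen_interior.mem_nhds hx] with y hy using G.sum_lambda hy
  have := congrArg (fun L : E2 →L[ℝ] ℝ => L z) (h1.unique h2)
  simpa using this

lemma lin_dlambda (L : E2 →L[ℝ] ℝ) (z : E2) :
    ∑ i, fderiv ℝ (fun y => P.lambda i y) x z * L (P.v i - x) = L z := by
  have h1 : HasFDerivAt (fun y => ∑ i, P.lambda i y * L (P.v i))
      (∑ i, L (P.v i) • fderiv ℝ (fun y => P.lambda i y) x) x :=
    HasFDerivAt.fun_sum fun i _ => (G.diff_lambda hx i).hasFDerivAt.mul_const _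
  have h2 : HasFDerivAt (fun y => ∑ i, P.lambda i y * L (P.v i)) L x := by
    refine L.hasFDerivAt.congr_of_eventuallyEq ?_
    filter_upwards [isOpen_interior.mem_nhds hx] with y hy
    have a := congrArg L (G.linear_prec hy)
    simp only [map_sum, map_smul, map_sub, smul_eq_mul, mul_sub, Finset.sum_sub_distrib,
      map_zero] at a
    rw [← Finset.sum_mul, G.sum_lambda hy, one_mul] at a
    linarith
  have := congrArg (fun L : E2 →L[ℝ] ℝ => L z) (h1.unique h2)
  simp only [ContinuousLinearMap.sum_apply, ContinuousLinearMap.smul_apply, smul_eq_mul] at this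
  simp only [map_sub, mul_sub, Finset.sum_sub_distrib]
  rw [← Finset.sum_mul, G.sum_dlambda hx, zero_mul, sub_zero, ← this]
  exact Finset.sum_congr rfl fun i _ => mul_comm _ _

end Good

/-- a bound for the number of vertices -/
def Nmax (δ : ℝ) : ℕ :=
  (Finset.Icc (-(⌈2 / δ⌉ + 1)) (⌈2 / δ⌉ + 1) ×ˢ
    Finset.Icc (-(⌈2 / δ⌉ + 1)) (⌈2 / δ⌉ + 1) : Finset (ℤ × ℤ)).card

lemma abs_coord_le (a : E2) (q : Fin 2) : |a q| ≤ ‖a‖ := by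
  apply abs_le_of_sq_le_sq _ (norm_nonneg _)
  rw [nsq]
  fin_cases q
  · simp; positivity
  · simp; positivity

lemma Good.n_le {n : ℕ} [NeZero n] {P : ConvexPolygon n} {σ d δ γ ρ : ℝ} {o : E2}
    (G : Good P σ d δ γ ρ o) : n ≤ Nmax δ := by
  have hδ := G.hδ
  have hd := G.hd
  have hs : 0 < δ * d / 2 := by positivity
  set f : Fin n → Fin 2 → ℝ := fun i q => (P.v i q - P.v 0 q) / (δ * d / 2) with hf
  have habs : ∀ i q, |f i q| ≤ 2 / δ := by
    intro i q
    have h1 := G.diam _ (P.v_mem i) _ (P.v_mem 0)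
    have h2 := abs_coord_le (P.v i - P.v 0) q
    rw [PiLp.sub_apply] at h2
    simp only [hf]
    rw [abs_div, abs_of_pos hs, div_le_div_iff₀ hs hδ]
    nlinarith
  have hfl : ∀ i q, ⌊f i q⌋ ∈ Finset.Icc (-(⌈2 / δ⌉ + 1)) (⌈2 / δ⌉ + 1) := by
    intro i q
    have h1 := abs_le.mp (habs i q)
    have h2 := Int.le_ceil (2 / δ)
    rw [Finset.mem_Icc]
    constructor
    · rw [Int.le_floor]; push_cast; linarith
    · have h3 : ((⌊f i q⌋ : ℤ) : ℝ) ≤ ((⌈2 / δ⌉ + 1 : ℤ) : ℝ) := by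
        push_cast
        linarith [Int.floor_le (f i q)]
      exact_mod_cast h3
  have hcell : ∀ i j q, ⌊f i q⌋ = ⌊f j q⌋ → (P.v i q - P.v j q) ^ 2 ≤ (δ * d / 2) ^ 2 := by
    intro i j q h
    have h1 := Int.abs_sub_lt_one_of_floor_eq_floor h
    have h2 : f i q - f j q = (P.v i q - P.v j q) / (δ * d / 2) := by
      simp only [hf]; ring
    rw [h2, abs_div, abs_of_pos hs, div_lt_one hs] at h1
    exact sq_le_sq' (by linarith [(abs_lt.mp h1).1]) (abs_lt.mp h1).2.le
  have := Finset.card_le_card_of_injOn (s := (Finset.univ : Finset (Fin n)))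
    (t := (Finset.Icc (-(⌈2 / δ⌉ + 1)) (⌈2 / δ⌉ + 1) ×ˢ
    Finset.Icc (-(⌈2 / δ⌉ + 1)) (⌈2 / δ⌉ + 1) : Finset (ℤ × ℤ)))
    (fun i => (⌊f i 0⌋, ⌊f i 1⌋))
    (fun i _ => by
      simp only [Finset.coe_product, Set.mem_prod, Finset.mem_coe]
      exact ⟨hfl i 0, hfl i 1⟩)
    (fun i _ j _ hij => by
      simp only [Prod.mk.injEq] at hij
      by_contra hne
      have s1 := G.sep i j hne
      have s2 := nsq (P.v i - P.v j)
      simp only [PiLp.sub_apply] at s2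
      have c0 := hcell i j 0 hij.1
      have c1 := hcell i j 1 hij.2
      have : (δ * d) ^ 2 ≤ ‖P.v i - P.v j‖ ^ 2 := by gcongr
      nlinarith [mul_pos hδ hd])
  rwa [Finset.card_univ, Fintype.card_fin] at this

lemma cs4 (a b p q r s : ℝ) : (a * a * p + a * b * q + b * a * r + b * b * s) ^ 2 ≤
    (a ^ 2 + b ^ 2) ^ 2 * (p ^ 2 + q ^ 2 + (r ^ 2 + s ^ 2)) := by
  nlinarith [sq_nonneg (a * a * q - a * b * p), sq_nonneg (a * a * r - b * a * p),
    sq_nonneg (a * a * s - b * b * p), sq_nonneg (a * b * r - b * a * q),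
    sq_nonneg (a * b * s - b * b * q), sq_nonneg (b * a * s - b * b * r)]

lemma D2sq_eq (u : E2 → ℝ) (x : E2) : D2sq u x = ∑ i : Fin 2, ∑ j : Fin 2,
    (fderiv ℝ (fderiv ℝ u) x (EuclideanSpace.single i 1) (EuclideanSpace.single j 1)) ^ 2 := by
  simp only [D2sq, iteratedFDeriv_two_apply]
  rfl

lemma D2sq_nonneg (u : E2 → ℝ) (x : E2) : 0 ≤ D2sq u x := by
  unfold D2sq; positivity

lemma hess_le (u : E2 → ℝ) (x h : E2) :
    (fderiv ℝ (fderiv ℝ u) x h h) ^ 2 ≤ ‖h‖ ^ 4 * D2sq u x := by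
  have e : h = h 0 • EuclideanSpace.single 0 (1:ℝ) + h 1 • EuclideanSpace.single 1 (1:ℝ) := by
    ext q; fin_cases q <;> simp
  have n4 : ‖h‖ ^ 4 = (h 0 ^ 2 + h 1 ^ 2) ^ 2 := by rw [← nsq]; ring
  rw [n4, D2sq_eq]
  simp only [Fin.sum_univ_two]
  refine le_trans (le_of_eq ?_) (cs4 (h 0) (h 1) _ _ _ _)
  congr 1
  set L := fderiv ℝ (fderiv ℝ u) x
  conv_lhs => rw [e]
  simp only [map_add, map_smul, add_apply, smul_apply, smul_eq_mul]
  ring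

section
variable {u : E2 → ℝ} {U : Set E2} (hU : IsOpen U) (hu : ContDiffOn ℝ 2 u U)
include hU hu

lemma hess_cont : ContinuousOn (fderiv ℝ (fderiv ℝ u)) U := by
  have h1 : ContDiffOn ℝ 1 (fderiv ℝ u) U := hu.fderiv_of_isOpen hU (by norm_num)
  have h2 : ContDiffOn ℝ 0 (fderiv ℝ (fderiv ℝ u)) U := h1.fderiv_of_isOpen hU (by norm_num)
  exact h2.continuousOn

lemma D2sq_cont : ContinuousOn (D2sq u) U := by
  have h := hess_cont hU hu
  have : D2sq u = fun x => ∑ i : Fin 2, ∑ j : Fin 2,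
    (fderiv ℝ (fderiv ℝ u) x (EuclideanSpace.single i 1) (EuclideanSpace.single j 1)) ^ 2 :=
    funext (D2sq_eq u)
  rw [this]
  fun_prop

lemma hasD_u {y : E2} (hy : y ∈ U) : HasFDerivAt u (fderiv ℝ u y) y :=
  ((hu.contDiffAt (hU.mem_nhds hy)).differentiableAt (by norm_num)).hasFDerivAt

lemma hasD_Du {y : E2} (hy : y ∈ U) : HasFDerivAt (fderiv ℝ u) (fderiv ℝ (fderiv ℝ u) y) y := by
  have h1 : ContDiffOn ℝ 1 (fderiv ℝ u) U := hu.fderiv_of_isOpen hU (by norm_num)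
  exact ((h1.contDiffAt (hU.mem_nhds hy)).differentiableAt (by norm_num)).hasFDerivAt

set_option maxHeartbeats 1000000 in
lemma taylor {v x : E2} (hseg : ∀ τ ∈ Set.Icc (0:ℝ) 1, v + τ • (x - v) ∈ U) {d : ℝ}
    (hd : ‖x - v‖ ≤ d) :
    (u v - u x - fderiv ℝ u x (v - x)) ^ 2 ≤
      d ^ 4 * ∫ τ in Set.Ioc (0:ℝ) 1, τ ^ 2 * D2sq u (v + τ • (x - v)) := by
  set h := x - v with hh
  have hline : ∀ τ : ℝ, HasDerivAt (fun τ : ℝ => v + τ • h) h τ := by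
    intro τ
    simpa using ((hasDerivAt_id τ).smul_const h).const_add v
  have hcl : Continuous (fun τ : ℝ => v + τ • h) := by fun_prop
  set ψ : ℝ → ℝ := fun τ => τ * fderiv ℝ (fderiv ℝ u) (v + τ • h) h h with hψ
  have hψc : ContinuousOn ψ (Set.Icc 0 1) := by
    have := (hess_cont hU hu).comp hcl.continuousOn (fun τ hτ => hseg τ hτ)
    have h2 : ContinuousOn (fun τ => fderiv ℝ (fderiv ℝ u) (v + τ • h)) (Set.Icc (0:ℝ) 1) := this
    simp only [hψ]
    fun_prop
  have hDc : ContinuousOn (fun τ : ℝ => τ ^ 2 * D2sq u (v + τ • h)) (Set.Icc 0 1) := by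
    have h2 : ContinuousOn (fun τ => D2sq u (v + τ • h)) (Set.Icc (0:ℝ) 1) :=
      (D2sq_cont hU hu).comp hcl.continuousOn (fun τ hτ => hseg τ hτ)
    fun_prop
  have hder : ∀ τ ∈ Set.uIcc (0:ℝ) 1,
      HasDerivAt (fun τ => τ * fderiv ℝ u (v + τ • h) h - u (v + τ • h)) (ψ τ) τ := by
    intro τ hτ
    rw [Set.uIcc_of_le zero_le_one] at hτ
    have hy := hseg τ hτ
    have a1 : HasDerivAt (fun τ => u (v + τ • h)) (fderiv ℝ u (v + τ • h) h) τ :=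
      (hasD_u hU hu hy).comp_hasDerivAt τ (hline τ)
    have a2' : HasDerivAt (fun τ => fderiv ℝ u (v + τ • h))
      (fderiv ℝ (fderiv ℝ u) (v + τ • h) h) τ :=
      (hasD_Du hU hu hy).comp_hasDerivAt τ (hline τ)
    have a2 : HasDerivAt (fun τ => fderiv ℝ u (v + τ • h) h)
      (fderiv ℝ (fderiv ℝ u) (v + τ • h) h h) τ :=
      (ContinuousLinearMap.apply ℝ ℝ h).hasFDerivAt.comp_hasDerivAt τ a2'
    have a3 := ((hasDerivAt_id' τ).fun_mul a2).fun_sub a1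
    refine a3.congr_deriv ?_
    simp only [hψ]
    ring
  have hψi : IntervalIntegrable ψ MeasureTheory.volume 0 1 :=
    (hψc.mono (by rw [Set.uIcc_of_le zero_le_one])).intervalIntegrable
  have hR := intervalIntegral.integral_eq_sub_of_hasDerivAt hder hψi
  have hψ2c : ContinuousOn (fun τ => ψ τ ^ 2) (Set.Icc 0 1) := by fun_prop
  have hψ2i : IntervalIntegrable (fun τ => ψ τ ^ 2) MeasureTheory.volume 0 1 :=
    (hψ2c.mono (by rw [Set.uIcc_of_le zero_le_one])).intervalIntegrable
  have hDi : IntervalIntegrable (fun τ : ℝ => d ^ 4 * (τ ^ 2 * D2sq u (v + τ • h)))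
      MeasureTheory.volume 0 1 :=
    ((hDc.mono (by rw [Set.uIcc_of_le zero_le_one])).intervalIntegrable).const_mul _
  set m := ∫ τ in (0:ℝ)..1, ψ τ with hm
  have hcs : m ^ 2 ≤ ∫ τ in (0:ℝ)..1, ψ τ ^ 2 := by
    have h0 : 0 ≤ ∫ τ in (0:ℝ)..1, (ψ τ - m) ^ 2 :=
      intervalIntegral.integral_nonneg zero_le_one fun τ _ => sq_nonneg _
    have e : ∀ τ, (ψ τ - m) ^ 2 = ψ τ ^ 2 - (2 * m) * ψ τ + m ^ 2 := fun τ => by ring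
    simp only [e] at h0
    rw [intervalIntegral.integral_add (hψ2i.sub (hψi.const_mul _)) (by simp),
      intervalIntegral.integral_sub hψ2i (hψi.const_mul _),
      intervalIntegral.integral_const_mul, ← hm] at h0
    simp only [intervalIntegral.integral_const, sub_zero, one_smul] at h0
    linarith
  have hRm : u v - u x - fderiv ℝ u x (v - x) = m := by
    rw [hR]
    have e1 : v + (1:ℝ) • h = x := by rw [hh]; simp
    have e2 : v - x = -h := by rw [hh]; abel
    rw [e1, e2]
    simp
    ring
  rw [hRm]
  refine hcs.trans ?_
  rw [← MeasureTheory.integral_const_mul, ← intervalIntegral.integral_of_le zero_le_one]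
  refine intervalIntegral.integral_mono_on zero_le_one hψ2i hDi fun τ hτ => ?_
  have b := hess_le u (v + τ • h) h
  have b2 : ‖h‖ ^ 4 ≤ d ^ 4 := by gcongr
  have b3 := D2sq_nonneg u (v + τ • h)
  calc ψ τ ^ 2 = τ ^ 2 * (fderiv ℝ (fderiv ℝ u) (v + τ • h) h h) ^ 2 := by simp only [hψ]; ring
    _ ≤ τ ^ 2 * (d ^ 4 * D2sq u (v + τ • h)) := by
      gcongr; exact b.trans (by gcongr)
    _ = _ := by ring

end

section
open MeasureTheory

lemma homothety {K : Set E2} (hK : Convex ℝ K) (hKc : IsCompact K) {g : E2 → ℝ}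
    (hg : ContinuousOn g K) (hg0 : ∀ x, 0 ≤ g x) {v : E2} (hv : v ∈ K) {τ : ℝ}
    (hτ : τ ∈ Set.Ioc (0:ℝ) 1) :
    ∫ x in K, τ ^ 2 * g (v + τ • (x - v)) ≤ ∫ x in K, g x := by
  have hKm : MeasurableSet K := hKc.measurableSet
  have hmem : ∀ x ∈ K, v + τ • (x - v) ∈ K := fun x hx =>
    hK.add_smul_sub_mem hv hx ⟨hτ.1.le, hτ.2⟩
  set F := K.indicator g with hF
  have hFi : Integrable F := (hg.integrableOn_compact hKc).integrable_indicator hKm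
  have hF0 : ∀ x, 0 ≤ F x := fun x => Set.indicator_nonneg (fun x _ => hg0 x) x
  have hFi1 : Integrable (fun y => F (v + y)) := hFi.comp_add_left v
  have hFi2 : Integrable (fun y => F (v + τ • y)) :=
    hFi1.comp_smul (R := τ) hτ.1.ne'
  have hFi3 : Integrable (fun x => F (v + τ • (x - v))) := hFi2.comp_sub_right v
  have h1 : ∫ x in K, τ ^ 2 * g (v + τ • (x - v)) = ∫ x in K, τ ^ 2 * F (v + τ • (x - v)) := by
    refine setIntegral_congr_fun hKm fun x hx => ?_
    simp only [hF, Set.indicator_of_mem (hmem x hx)]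
  rw [h1, integral_const_mul]
  have h2 : ∫ x in K, F (v + τ • (x - v)) ≤ ∫ x, F (v + τ • (x - v)) :=
    setIntegral_le_integral hFi3 (Filter.Eventually.of_forall fun x => hF0 _)
  have h3 : ∫ x, F (v + τ • (x - v)) = (τ ^ 2)⁻¹ * ∫ x in K, g x := by
    rw [integral_sub_right_eq_self (fun y => F (v + τ • y)) v,
      Measure.integral_comp_smul volume (fun y => F (v + y)) τ,
      integral_add_left_eq_self F v, hF, integral_indicator hKm]
    have : 0 < τ := hτ.1
    simp only [finrank_euclideanSpace, Fintype.card_fin, smul_eq_mul]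
    rw [abs_of_nonneg (by positivity)]
  rw [h3] at h2
  have h4 : 0 < τ ^ 2 := pow_pos hτ.1 2
  calc _ ≤ τ ^ 2 * ((τ ^ 2)⁻¹ * ∫ x in K, g x) := by gcongr
    _ = _ := by rw [← mul_assoc, mul_inv_cancel₀ h4.ne', one_mul]

lemma fubini_bound {K : Set E2} (hK : Convex ℝ K) (hKc : IsCompact K) {g : E2 → ℝ}
    (hg : ContinuousOn g K) (hg0 : ∀ x, 0 ≤ g x) {v : E2} (hv : v ∈ K) :
    IntegrableOn (fun x => ∫ τ in Set.Ioc (0:ℝ) 1, τ ^ 2 * g (v + τ • (x - v))) K ∧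
    ∫ x in K, ∫ τ in Set.Ioc (0:ℝ) 1, τ ^ 2 * g (v + τ • (x - v)) ≤ ∫ x in K, g x := by
  have hc : ContinuousOn (fun p : E2 × ℝ => p.2 ^ 2 * g (v + p.2 • (p.1 - v)))
      (K ×ˢ Set.Icc (0:ℝ) 1) := by
    have h1 : ContinuousOn (fun p : E2 × ℝ => g (v + p.2 • (p.1 - v)))
        (K ×ˢ Set.Icc (0:ℝ) 1) := by
      refine hg.comp (f := fun p : E2 × ℝ => v + p.2 • (p.1 - v)) (by fun_prop) ?_
      rintro ⟨x, τ⟩ ⟨hx, hτ⟩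
      exact hK.add_smul_sub_mem hv hx hτ
    exact ContinuousOn.mul (by fun_prop) h1
  have hi : IntegrableOn (fun p : E2 × ℝ => p.2 ^ 2 * g (v + p.2 • (p.1 - v)))
      (K ×ˢ Set.Ioc (0:ℝ) 1) (volume.prod volume) :=
    (hc.integrableOn_compact (μ := volume.prod volume) (hKc.prod isCompact_Icc)).mono_set
      (Set.prod_mono le_rfl Set.Ioc_subset_Icc_self)
  have hi' : Integrable (Function.uncurry fun (x : E2) (τ : ℝ) => τ ^ 2 * g (v + τ • (x - v)))
      ((volume.restrict K).prod (volume.restrict (Set.Ioc (0:ℝ) 1))) := by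
    rw [Measure.prod_restrict]; exact hi
  refine ⟨hi'.integral_prod_left, ?_⟩
  rw [integral_integral_swap hi']
  have hle : ∫ τ in Set.Ioc (0:ℝ) 1, ∫ x in K, τ ^ 2 * g (v + τ • (x - v)) ≤
      ∫ τ in Set.Ioc (0:ℝ) 1, ∫ x in K, g x := by
    refine integral_mono_of_nonneg ?_ (by simp) ?_
    · refine Filter.Eventually.of_forall fun τ => integral_nonneg fun x => ?_
      exact mul_nonneg (sq_nonneg _) (hg0 _)
    · refine (ae_restrict_iff' measurableSet_Ioc).mpr (Filter.Eventually.of_forall fun τ hτ => ?_)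
      exact homothety hK hKc hg hg0 hv hτ
  refine hle.trans (le_of_eq ?_)
  simp

end

lemma Cgrad_nonneg {γ δ : ℝ} (hγ : 0 < γ) (hδ : 0 < δ) : 0 ≤ Cgrad γ δ := by
  unfold Cgrad
  positivity

namespace Good
variable {n : ℕ} [NeZero n] {P : ConvexPolygon n} {σ d δ γ ρ : ℝ} {o : E2}
  (G : Good P σ d δ γ ρ o) {x : E2} (hx : x ∈ interior P.region)
include G hx

lemma pointwise {u : E2 → ℝ} (hu : DifferentiableAt ℝ u x) {R : Fin n → ℝ}
    (hR : ∀ i, R i = u (P.v i) - u x - fderiv ℝ u x (P.v i - x)) :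
    (u x - ∑ i : Fin n, u (P.v i) * P.lambda i x) ^ 2 +
      ‖gradient (fun y => u y - ∑ i : Fin n, u (P.v i) * P.lambda i y) x‖ ^ 2 ≤
    (n + (n * (Cgrad γ δ * d⁻¹)) ^ 2 * n) * ∑ i, R i ^ 2 := by
  have huv : ∀ i, u (P.v i) = R i + u x + fderiv ℝ u x (P.v i - x) := fun i => by
    rw [hR i]; ring
  have hd := G.hd
  have hC := Cgrad_nonneg G.hγ G.hδ
  have e1 : u x - ∑ i : Fin n, u (P.v i) * P.lambda i x = -∑ i, R i * P.lambda i x := by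
    have a := congrArg (fderiv ℝ u x) (G.linear_prec hx)
    simp only [map_sum, map_smul, smul_eq_mul, map_zero] at a
    have b : ∑ i : Fin n, u (P.v i) * P.lambda i x = ∑ i, R i * P.lambda i x
        + u x * ∑ i, P.lambda i x + ∑ i, P.lambda i x * fderiv ℝ u x (P.v i - x) := by
      rw [Finset.mul_sum, ← Finset.sum_add_distrib, ← Finset.sum_add_distrib]
      refine Finset.sum_congr rfl fun i _ => ?_
      rw [huv i]; ring
    rw [b, a, G.sum_lambda hx]; ring
  have hf : HasFDerivAt (fun y => u y - ∑ i : Fin n, u (P.v i) * P.lambda i y)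
      (fderiv ℝ u x - ∑ i, u (P.v i) • fderiv ℝ (fun y => P.lambda i y) x) x :=
    hu.hasFDerivAt.sub (HasFDerivAt.fun_sum fun i _ =>
      (G.diff_lambda hx i).hasFDerivAt.const_mul (u (P.v i)))
  have e2 : ∀ z, (fderiv ℝ u x - ∑ i, u (P.v i) • fderiv ℝ (fun y => P.lambda i y) x) z
      = -∑ i, R i * fderiv ℝ (fun y => P.lambda i y) x z := by
    intro z
    have a := G.lin_dlambda hx (fderiv ℝ u x) z
    have b := G.sum_dlambda hx z
    have c : ∑ i, u (P.v i) * fderiv ℝ (fun y => P.lambda i y) x z =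
        ∑ i, R i * fderiv ℝ (fun y => P.lambda i y) x z
        + u x * ∑ i, fderiv ℝ (fun y => P.lambda i y) x z
        + ∑ i, fderiv ℝ (fun y => P.lambda i y) x z * fderiv ℝ u x (P.v i - x) := by
      rw [Finset.mul_sum, ← Finset.sum_add_distrib, ← Finset.sum_add_distrib]
      refine Finset.sum_congr rfl fun i _ => ?_
      rw [huv i]; ring
    simp only [sub_apply, sum_apply, smul_apply, smul_eq_mul]
    rw [c, a, b]; ring
  have hS0 : 0 ≤ ∑ i, |R i| := Finset.sum_nonneg fun i _ => abs_nonneg _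
  have hSsq : (∑ i, |R i|) ^ 2 ≤ n * ∑ i, R i ^ 2 := by
    have := sq_sum_le_card_mul_sum_sq (s := (Finset.univ : Finset (Fin n))) (f := fun i => |R i|)
    simpa using this
  have b1 : (u x - ∑ i : Fin n, u (P.v i) * P.lambda i x) ^ 2 ≤ n * ∑ i, R i ^ 2 := by
    refine le_trans ?_ hSsq
    rw [e1, neg_sq]
    refine sq_le_sq.mpr ?_
    rw [abs_of_nonneg hS0]
    refine (Finset.abs_sum_le_sum_abs _ _).trans (Finset.sum_le_sum fun i _ => ?_)
    rw [abs_mul, abs_of_nonneg (G.lambda_nonneg hx i)]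
    exact mul_le_of_le_one_right (abs_nonneg _) (G.lambda_le_one hx i)
  have b2 : ‖gradient (fun y => u y - ∑ i : Fin n, u (P.v i) * P.lambda i y) x‖ ≤
      n * (Cgrad γ δ * d⁻¹) * ∑ i, |R i| := by
    rw [gradient, LinearIsometryEquiv.norm_map, hf.fderiv]
    refine ContinuousLinearMap.opNorm_le_bound _ (by positivity) fun z => ?_
    rw [e2, norm_neg, Real.norm_eq_abs]
    refine (Finset.abs_sum_le_sum_abs _ _).trans ?_
    rw [Finset.mul_sum, Finset.sum_mul]
    refine Finset.sum_le_sum fun i _ => ?_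
    rw [abs_mul]
    calc _ ≤ |R i| * (n * (Cgrad γ δ * d⁻¹) * ‖z‖) := by
          gcongr; exact G.grad_lambda hx i z
      _ = _ := by ring
  have b3 : ‖gradient (fun y => u y - ∑ i : Fin n, u (P.v i) * P.lambda i y) x‖ ^ 2 ≤
      (n * (Cgrad γ δ * d⁻¹)) ^ 2 * (n * ∑ i, R i ^ 2) := by
    calc _ ≤ (n * (Cgrad γ δ * d⁻¹) * ∑ i, |R i|) ^ 2 := by gcongr
      _ = (n * (Cgrad γ δ * d⁻¹)) ^ 2 * (∑ i, |R i|) ^ 2 := by ring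
      _ ≤ _ := by gcongr
  calc _ ≤ _ := add_le_add b1 b3
    _ = _ := by ring

omit hx in
open MeasureTheory in
lemma main_bound (hd1 : d ≤ 1) {u : E2 → ℝ} {U : Set E2} (hU : IsOpen U) (hsub : P.region ⊆ U)
    (hu : ContDiffOn ℝ 2 u U) :
    ∫ x in P.region,
        ((u x - ∑ i : Fin n, u (P.v i) * P.lambda i x) ^ 2 +
          ‖gradient (fun y => u y - ∑ i : Fin n, u (P.v i) * P.lambda i y) x‖ ^ 2)
      ≤ ((n : ℝ) ^ 2 + ((n : ℝ) ^ 2 * Cgrad γ δ) ^ 2) * d ^ 2 * ∫ x in P.region, D2sq u x := by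
  have hd := G.hd
  have hC := Cgrad_nonneg G.hγ G.hδ
  have hKm : MeasurableSet P.region := P.region_compact.measurableSet
  have hg : ContinuousOn (D2sq u) P.region := (D2sq_cont hU hu).mono hsub
  have hfub := fun i => fubini_bound P.region_convex P.region_compact hg (D2sq_nonneg u)
    (P.v_mem i)
  set H : Fin n → E2 → ℝ := fun i x =>
    ∫ τ in Set.Ioc (0:ℝ) 1, τ ^ 2 * D2sq u (P.v i + τ • (x - P.v i)) with hH
  set A : ℝ := (n + (n * (Cgrad γ δ * d⁻¹)) ^ 2 * n) * d ^ 4 with hA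
  have hA0 : 0 ≤ A := by positivity
  have hI0 : 0 ≤ ∫ x in P.region, D2sq u x := integral_nonneg fun x => D2sq_nonneg u x
  have hInt : ∀ᵐ x ∂(volume.restrict P.region), x ∈ interior P.region := by
    rw [ae_restrict_iff' hKm]
    have h0 : volume (frontier P.region) = 0 := P.region_convex.addHaar_frontier volume
    have h1 : ∀ᵐ x ∂(volume : Measure E2), x ∉ frontier P.region := measure_eq_zero_iff_ae_notMem.mp h0
    filter_upwards [h1] with x hx hxK
    by_contra hni
    exact hx ⟨subset_closure hxK, hni⟩
  have step : ∫ x in P.region,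
        ((u x - ∑ i : Fin n, u (P.v i) * P.lambda i x) ^ 2 +
          ‖gradient (fun y => u y - ∑ i : Fin n, u (P.v i) * P.lambda i y) x‖ ^ 2) ≤
      ∫ x in P.region, A * ∑ i, H i x := by
    refine integral_mono_of_nonneg (Filter.Eventually.of_forall fun x => by positivity) ?_ ?_
    · exact (integrable_finsetSum _ fun i _ => (hfub i).1).const_mul A
    · filter_upwards [hInt] with x hx
      have hxK : x ∈ P.region := interior_subset hx
      have hp := G.pointwise hx (u := u) (hasD_u hU hu (hsub hxK)).differentiableAt
        (R := fun i => u (P.v i) - u x - fderiv ℝ u x (P.v i - x)) (fun i => rfl)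
      refine hp.trans ?_
      have ht : ∀ i, (u (P.v i) - u x - fderiv ℝ u x (P.v i - x)) ^ 2 ≤ d ^ 4 * H i x :=
        fun i => taylor hU hu (fun τ hτ => hsub
          (P.region_convex.add_smul_sub_mem (P.v_mem i) hxK hτ)) (G.diam _ hxK _ (P.v_mem i))
      calc _ ≤ (n + (n * (Cgrad γ δ * d⁻¹)) ^ 2 * n) * ∑ i, d ^ 4 * H i x := by
            gcongr with i _
            exact ht i
        _ = _ := by rw [← Finset.mul_sum, hA]; ring
  refine step.trans ?_
  rw [integral_const_mul, integral_finsetSum _ fun i _ => (hfub i).1]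
  have hsum : ∑ i, ∫ x in P.region, H i x ≤ n * ∫ x in P.region, D2sq u x := by
    calc _ ≤ ∑ i : Fin n, ∫ x in P.region, D2sq u x := Finset.sum_le_sum fun i _ => (hfub i).2
      _ = _ := by simp
  calc _ ≤ A * (n * ∫ x in P.region, D2sq u x) := by gcongr
    _ = ((n : ℝ) ^ 2 * d ^ 2 + ((n : ℝ) ^ 2 * Cgrad γ δ) ^ 2) * d ^ 2 *
          ∫ x in P.region, D2sq u x := by
        rw [hA]; field_simp
    _ ≤ _ := by
        have : (n : ℝ) ^ 2 * d ^ 2 ≤ (n : ℝ) ^ 2 :=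
          mul_le_of_le_one_right (by positivity) (by nlinarith)
        gcongr

end Good

open ConvexPolygon in
/-- optimal interpolation error estimate for the mean value coordinates:
under G1 and the scaled minimum edge length condition, the mean value interpolant
satisfies `‖u − Iu‖²_{H¹(Ω)} ≤ C² diam(Ω)² |u|²_{H²(Ω)}`. -/
theorem mean_value_interpolation_estimate (γstar dstar : ℝ) (hγ : 0 < γstar) (hd : 0 < dstar) :
    ∃ C : ℝ, 0 < C ∧
      ∀ (n : ℕ) [NeZero n] (P : ConvexPolygon n),
        Metric.diam P.region ≤ 1 →
        Metric.diam P.region / P.inradius < γstar →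
        (∀ i j : Fin n, i ≠ j → dstar * Metric.diam P.region < dist (P.v i) (P.v j)) →
        ∀ u : E2 → ℝ,
          (∃ U : Set E2, IsOpen U ∧ P.region ⊆ U ∧ ContDiffOn ℝ 2 u U) →
          ∫ x in P.region,
              ((u x - ∑ i : Fin n, u (P.v i) * P.lambda i x) ^ 2 +
                ‖gradient (fun y => u y - ∑ i : Fin n, u (P.v i) * P.lambda i y) x‖ ^ 2)
            ≤ C ^ 2 * Metric.diam P.region ^ 2 * ∫ x in P.region, D2sq u x := by
  have hC0 := Cgrad_nonneg hγ hd
  refine ⟨1 + (Nmax dstar : ℝ) + (Nmax dstar : ℝ) ^ 2 * Cgrad γstar dstar, by positivity, ?_⟩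
  intro n _ P hd1 h1 h2 u ⟨U, hU, hsub, hu⟩
  rcases Set.eq_empty_or_nonempty (interior P.region) with hInt | hInt
  · have h0 : MeasureTheory.volume P.region = 0 := by
      have h3 := P.region_convex.addHaar_frontier MeasureTheory.volume
      refine MeasureTheory.measure_mono_null ?_ h3
      intro x hx
      exact ⟨subset_closure hx, by rw [hInt]; simp⟩
    rw [MeasureTheory.Measure.restrict_eq_zero.mpr h0]
    simp
  · obtain ⟨σ, ρ, o, G⟩ := exists_good P hγ hd hInt h1 h2
    refine (G.main_bound hd1 hU hsub hu).trans ?_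
    have hI0 : 0 ≤ ∫ x in P.region, D2sq u x :=
      MeasureTheory.integral_nonneg fun x => D2sq_nonneg u x
    have hn : (n : ℝ) ≤ Nmax dstar := by exact_mod_cast G.n_le
    gcongr
    calc (n : ℝ) ^ 2 + ((n : ℝ) ^ 2 * Cgrad γstar dstar) ^ 2
        ≤ (Nmax dstar : ℝ) ^ 2 + ((Nmax dstar : ℝ) ^ 2 * Cgrad γstar dstar) ^ 2 := by gcongr
      _ ≤ _ := by
        have a : 0 ≤ (Nmax dstar : ℝ) := by positivity
        have b : 0 ≤ (Nmax dstar : ℝ) ^ 2 * Cgrad γstar dstar := by positivity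
        nlinarith [mul_nonneg a b]
end
end

section
/- Let a, b, x ∈ ℝ² be three points that are not collinear, let α(y) := ∠ a y b (the Euclidean angle at y between a − y and b − y), and let t(y) := tan(α(y)/2). Then t is differentiable at x and ‖∇t(x)‖ ≤ (1/(2·cos²(α(x)/2))) · (1/|x − a| + 1/|x − b|). -/
open EuclideanGeometry Metric Real

noncomputable section

lemma aux_norm (u v : E2) (hu : u ≠ 0) (hv : v ≠ 0) :
    ‖(1 / (‖u‖ * ‖v‖)) • v - ((inner ℝ u v / (‖u‖ * ‖v‖)) / ‖u‖ ^ 2) • u‖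
      ≤ √(1 - (inner ℝ u v / (‖u‖ * ‖v‖)) ^ 2) / ‖u‖ := by
  have hu' : 0 < ‖u‖ := norm_pos_iff.2 hu
  have hv' : 0 < ‖v‖ := norm_pos_iff.2 hv
  rw [le_div_iff₀ hu']
  apply Real.le_sqrt_of_sq_le
  rw [mul_pow, @norm_sub_sq_real, norm_smul, norm_smul, inner_smul_left, inner_smul_right,
    real_inner_comm u v, mul_pow, mul_pow, Real.norm_eq_abs, Real.norm_eq_abs, sq_abs, sq_abs]
  simp only [conj_trivial]
  apply le_of_eq
  field_simp
  ring

lemma aux_deriv_norm (u h : E2) (hu : u ≠ 0) :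
    HasDerivAt (fun s : ℝ => ‖u - s • h‖) (-(inner ℝ u h) / ‖u‖) 0 := by
  have hu' : 0 < ‖u‖ := norm_pos_iff.2 hu
  have h1 : HasDerivAt (fun s : ℝ => u - s • h) (-h) 0 := by
    simpa using ((hasDerivAt_id (0 : ℝ)).smul_const h).const_sub u
  have h2 := h1.norm_sq.sqrt (by simpa using hu)
  simp only [Real.sqrt_sq (norm_nonneg _), zero_smul, sub_zero, inner_neg_right] at h2
  convert h2 using 1
  field_simp

lemma aux_deriv_cos (u v h : E2) (hu : u ≠ 0) (hv : v ≠ 0) :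
    HasDerivAt (fun s : ℝ => inner ℝ (u - s • h) (v - s • h) / (‖u - s • h‖ * ‖v - s • h‖))
      (-(inner ℝ h ((1 / (‖u‖ * ‖v‖)) • v - ((inner ℝ u v / (‖u‖ * ‖v‖)) / ‖u‖ ^ 2) • u)
       + inner ℝ h ((1 / (‖v‖ * ‖u‖)) • u - ((inner ℝ v u / (‖v‖ * ‖u‖)) / ‖v‖ ^ 2) • v))) 0 := by
  have hu' : 0 < ‖u‖ := norm_pos_iff.2 hu
  have hv' : 0 < ‖v‖ := norm_pos_iff.2 hv
  have h1 : ∀ u : E2, HasDerivAt (fun s : ℝ => u - s • h) (-h) 0 := fun u => by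
    simpa using ((hasDerivAt_id (0 : ℝ)).smul_const h).const_sub u
  have h2 := ((h1 u).inner ℝ (h1 v)).div ((aux_deriv_norm u h hu).mul (aux_deriv_norm v h hv))
    (by simp [hu, hv])
  refine h2.congr_deriv ?_
  simp only [Pi.mul_apply, zero_smul, sub_zero, inner_neg_right, inner_neg_left, inner_sub_right, inner_smul_right]
  rw [real_inner_comm u v, real_inner_comm u h, real_inner_comm v h]
  field_simp
  ring

/-- For non-collinear `a, b, x ∈ ℝ²`, with `α(y) := ∠ a y b` and
`t(y) := tan(α(y)/2)`, the function `t` is differentiable at `x` and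
`‖∇t(x)‖ ≤ (1/(2 cos²(α(x)/2))) (1/|x − a| + 1/|x − b|)`. -/
theorem gradient_tan_half_angle_bound (a b x : E2)
    (hcol : ¬ Collinear ℝ ({a, b, x} : Set E2)) :
    DifferentiableAt ℝ (fun y : E2 => Real.tan (∠ a y b / 2)) x ∧
      ‖gradient (fun y : E2 => Real.tan (∠ a y b / 2)) x‖ ≤
        (1 / (2 * Real.cos (∠ a x b / 2) ^ 2)) * (1 / dist x a + 1 / dist x b) := by
  have hcol' : ¬ Collinear ℝ ({a, x, b} : Set E2) := by
    rwa [show ({a, x, b} : Set E2) = {a, b, x} by rw [Set.pair_comm]]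
  have hax : a - x ≠ 0 := sub_ne_zero.2 (ne₁₂_of_not_collinear hcol')
  have hbx : b - x ≠ 0 := sub_ne_zero.2 (ne₂₃_of_not_collinear hcol').symm
  have hpos : 0 < ∠ a x b := angle_pos_of_not_collinear hcol'
  have hlt : ∠ a x b < π := angle_lt_pi_of_not_collinear hcol'
  have hcos : Real.cos (∠ a x b / 2) ≠ 0 :=
    (Real.cos_pos_of_mem_Ioo ⟨by linarith, by linarith⟩).ne'
  have hang : ∀ y, ∠ a y b = Real.arccos (inner ℝ (a - y) (b - y) / (‖a - y‖ * ‖b - y‖)) :=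
    fun y => rfl
  set c := inner ℝ (a - x) (b - x) / (‖a - x‖ * ‖b - x‖) with hc
  have hc1 : c ≠ 1 := by
    intro h; rw [hang, ← hc, h, Real.arccos_one] at hpos; exact lt_irrefl _ hpos
  have hcm : c ≠ -1 := by
    intro h; rw [hang, ← hc, h, Real.arccos_neg_one] at hlt; exact lt_irrefl _ hlt
  have hsin : 0 < √(1 - c ^ 2) := by
    rw [← Real.sin_arccos]
    exact Real.sin_pos_of_pos_of_lt_pi hpos hlt
  have hdiff : DifferentiableAt ℝ (fun y : E2 => Real.tan (∠ a y b / 2)) x := by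
    have h1 : DifferentiableAt ℝ (fun y : E2 => a - y) x := by fun_prop
    have h2 : DifferentiableAt ℝ (fun y : E2 => b - y) x := by fun_prop
    have h30 : DifferentiableAt ℝ (fun y : E2 => ‖a - y‖ * ‖b - y‖) x :=
      (h1.norm ℝ hax).mul (h2.norm ℝ hbx)
    have h31 : DifferentiableAt ℝ (fun y : E2 => (‖a - y‖ * ‖b - y‖)⁻¹) x :=
      h30.inv (mul_ne_zero (norm_ne_zero_iff.2 hax) (norm_ne_zero_iff.2 hbx))
    have h3 : DifferentiableAt ℝ
        (fun y : E2 => inner ℝ (a - y) (b - y) / (‖a - y‖ * ‖b - y‖)) x := by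
      simp only [div_eq_mul_inv]
      exact (h1.inner ℝ h2).mul h31
    have h4 : DifferentiableAt ℝ (fun y : E2 => ∠ a y b) x :=
      (Real.differentiableAt_arccos.2 ⟨hcm, hc1⟩).comp x h3
    have h5 : DifferentiableAt ℝ (fun y : E2 => ∠ a y b / 2) x := by
      simp only [div_eq_mul_inv]
      exact h4.mul_const _
    exact DifferentiableAt.comp (g := Real.tan) x (Real.differentiableAt_tan.2 hcos) h5
  refine ⟨hdiff, ?_⟩
  rw [gradient, LinearIsometryEquiv.norm_map]
  refine ContinuousLinearMap.opNorm_le_bound _ (by positivity) fun h => ?_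
  have hline : HasDerivAt (fun s : ℝ => x + s • h) h 0 := by
    simpa using ((hasDerivAt_id (0 : ℝ)).smul_const h).const_add x
  have hd1 : HasDerivAt (fun s : ℝ => Real.tan (∠ a (x + s • h) b / 2))
      (fderiv ℝ (fun y : E2 => Real.tan (∠ a y b / 2)) x h) 0 := by
    exact HasFDerivAt.comp_hasDerivAt_of_eq (0 : ℝ) hdiff.hasFDerivAt hline (by simp)
  have hd2 := aux_deriv_cos (a - x) (b - x) h hax hbx
  set D := (-(inner ℝ h ((1 / (‖a - x‖ * ‖b - x‖)) • (b - x) - (c / ‖a - x‖ ^ 2) • (a - x))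
       + inner ℝ h ((1 / (‖b - x‖ * ‖a - x‖)) • (a - x) -
        ((inner ℝ (b - x) (a - x) / (‖b - x‖ * ‖a - x‖)) / ‖b - x‖ ^ 2) • (b - x)))) with hD
  have hDle : |D| ≤ √(1 - c ^ 2) * (1 / dist x a + 1 / dist x b) * ‖h‖ := by
    have e1 := aux_norm (a - x) (b - x) hax hbx
    have e2 := aux_norm (b - x) (a - x) hbx hax
    have hcc : inner ℝ (b - x) (a - x) / (‖b - x‖ * ‖a - x‖) = c := by
      rw [hc, real_inner_comm, mul_comm]
    rw [hcc] at e2 hD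
    rw [← hc] at e1
    rw [hD, abs_neg, dist_comm x a, dist_comm x b, dist_eq_norm, dist_eq_norm]
    refine (abs_add_le _ _).trans ?_
    have f1 := (abs_real_inner_le_norm h _).trans (mul_le_mul_of_nonneg_left e1 (norm_nonneg h))
    have f2 := (abs_real_inner_le_norm h _).trans (mul_le_mul_of_nonneg_left e2 (norm_nonneg h))
    refine (add_le_add f1 f2).trans (le_of_eq ?_)
    ring
  have hd3 : HasDerivAt (fun s : ℝ => Real.tan (∠ a (x + s • h) b / 2))
      (1 / Real.cos (∠ a x b / 2) ^ 2 * ((-(1 / √(1 - c ^ 2)) * D) / 2)) 0 := by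
    have g1 : HasDerivAt (fun s : ℝ => ∠ a (x + s • h) b) (-(1 / √(1 - c ^ 2)) * D) 0 := by
      have := HasDerivAt.comp_of_eq (0 : ℝ) (Real.hasDerivAt_arccos hcm hc1) hd2 (by simp [hc])
      refine this.congr_of_eventuallyEq (Filter.Eventually.of_forall fun s => ?_)
      simp only [hang, Function.comp, sub_sub]
    exact HasDerivAt.comp_of_eq (0 : ℝ) (Real.hasDerivAt_tan hcos) (g1.div_const 2) (by simp)
  rw [hd1.unique hd3, Real.norm_eq_abs, abs_mul, abs_div (_ * D), abs_mul, abs_neg,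
    abs_of_pos (show 0 < 1 / √(1 - c ^ 2) by positivity), abs_of_nonneg (show 0 ≤ 1 / Real.cos (∠ a x b / 2) ^ 2 by positivity), abs_two]
  have : 1 / √(1 - c ^ 2) * |D| ≤ (1 / dist x a + 1 / dist x b) * ‖h‖ := by
    rw [one_div_mul_eq_div, div_le_iff₀ hsin]
    linarith
  calc _ ≤ 1 / Real.cos (∠ a x b / 2) ^ 2 * ((1 / dist x a + 1 / dist x b) * ‖h‖ / 2) := by gcongr
    _ = _ := by ring
end
end

section
/- Let a, b, x ∈ ℝ² be three non-collinear points with ∠ a x b ≥ π/2. Then the distance from x to the segment [a, b] satisfies dist(x, [a, b]) ≤ max(|x − a|, |x − b|) / tan(∠ a x b / 2). -/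
open EuclideanGeometry Metric Real

noncomputable section

/-- For non-collinear `a, b, x ∈ ℝ²` with `∠ a x b ≥ π/2`, the distance from
`x` to the segment `[a,b]` is at most `max(|x−a|, |x−b|) / tan(∠ a x b / 2)`. -/
theorem dist_to_segment_le (a b x : E2)
    (hcol : ¬ Collinear ℝ ({a, x, b} : Set E2))
    (hang : Real.pi / 2 ≤ ∠ a x b) :
    Metric.infDist x (segment ℝ a b) ≤
      max (dist x a) (dist x b) / Real.tan (∠ a x b / 2) := by
  have hxa : x ≠ a := by
    rintro rfl
    exact hcol (by simpa using collinear_pair ℝ x b)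
  have hxb : x ≠ b := by
    rintro rfl
    exact hcol (by simpa using collinear_pair ℝ a x)
  have hp : 0 < dist x a := dist_pos.2 hxa
  have hq : 0 < dist x b := dist_pos.2 hxb
  have hpi : ∠ a x b ≤ Real.pi := EuclideanGeometry.angle_le_pi a x b
  have hpi0 := Real.pi_pos
  have hin : inner ℝ (a - x) (b - x) = dist x a * dist x b * Real.cos (∠ a x b) := by
    have h := InnerProductGeometry.cos_angle_mul_norm_mul_norm (a - x) (b - x)
    rw [← dist_eq_norm, ← dist_eq_norm, dist_comm a x, dist_comm b x] at h
    rw [← h, EuclideanGeometry.angle, vsub_eq_sub, vsub_eq_sub]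
    ring
  have hna : ‖a - x‖ = dist x a := by rw [dist_comm, dist_eq_norm]
  have hnb : ‖b - x‖ = dist x b := by rw [dist_comm, dist_eq_norm]
  set p := dist x a
  set q := dist x b
  set θ := ∠ a x b
  have hc : 0 ≤ Real.cos (θ / 2) :=
    Real.cos_nonneg_of_mem_Icc ⟨by linarith, by linarith⟩
  have hs : 0 < Real.sin (θ / 2) := Real.sin_pos_of_pos_of_lt_pi (by linarith) (by linarith)
  have hcos : Real.cos θ = 2 * Real.cos (θ / 2) ^ 2 - 1 := by
    rw [← Real.cos_two_mul]; congr 1; ring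
  have hnorm : ‖q • (a - x) + p • (b - x)‖ = 2 * p * q * Real.cos (θ / 2) := by
    rw [← sq_eq_sq₀ (norm_nonneg _) (by positivity), norm_add_sq_real, norm_smul, norm_smul,
      real_inner_smul_left, real_inner_smul_right, hin, hna, hnb, hcos,
      Real.norm_of_nonneg hp.le, Real.norm_of_nonneg hq.le]
    ring
  have hpq : 0 < p + q := by positivity
  have hmem : (q / (p + q)) • a + (p / (p + q)) • b ∈ segment ℝ a b :=
    ⟨q / (p + q), p / (p + q), by positivity, by positivity, by field_simp; ring, rfl⟩
  have hd : dist x ((q / (p + q)) • a + (p / (p + q)) • b)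
      = 2 * p * q * Real.cos (θ / 2) / (p + q) := by
    have e : (q / (p + q)) • a + (p / (p + q)) • b - x
        = (p + q)⁻¹ • (q • (a - x) + p • (b - x)) := by
      ext i
      simp
      field_simp
      ring
    rw [dist_comm, dist_eq_norm, e, norm_smul, hnorm, Real.norm_of_nonneg (by positivity)]
    field_simp
  refine (Metric.infDist_le_dist_of_mem hmem).trans ?_
  rw [hd, Real.tan_eq_sin_div_cos, div_div_eq_mul_div]
  have hM : 2 * p * q ≤ max p q * (p + q) := by
    have h1 := le_max_left p q
    have h2 := le_max_right p q
    nlinarith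
  have hM0 : 0 ≤ max p q := hp.le.trans (le_max_left _ _)
  calc 2 * p * q * Real.cos (θ / 2) / (p + q)
      ≤ max p q * Real.cos (θ / 2) := by
        rw [div_le_iff₀ hpq]
        nlinarith [mul_le_mul_of_nonneg_right hM hc]
    _ ≤ _ := by
        rw [le_div_iff₀ hs]
        exact mul_le_of_le_one_right (by positivity) (Real.sin_le_one _)
end
end

section
/- Let A, B, X ∈ ℝ² be three non-collinear points with |X − B| < |A − B|/2. Then ∠ X A B < (∠ A X B)/2. -/
open EuclideanGeometry Metric Real

noncomputable section

/-- For non-collinear `A, B, X ∈ ℝ²` with `|X − B| < |A − B|/2`,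
we have `∠ X A B < (∠ A X B)/2`. -/
theorem angle_at_far_vertex_lt (A B X : E2)
    (hcol : ¬ Collinear ℝ ({A, B, X} : Set E2))
    (h : dist X B < dist A B / 2) :
    ∠ X A B < ∠ A X B / 2 := by
  have hc1 : ¬ Collinear ℝ ({X, A, B} : Set E2) := by
    have : ({X, A, B} : Set E2) = {A, B, X} := by ext; simp; tauto
    rwa [this]
  have hc2 : ¬ Collinear ℝ ({A, X, B} : Set E2) := by
    have : ({A, X, B} : Set E2) = {A, B, X} := by ext; simp; tauto
    rwa [this]
  have hXB : 0 < dist X B := dist_pos.2 (ne₂₃_of_not_collinear hc2)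
  have hXA : X ≠ A := ne₁₂_of_not_collinear hc1
  have hs : 0 < Real.sin (∠ X A B) := sin_pos_of_not_collinear hc1
  have hs2 : 0 < Real.sin (∠ A X B) := sin_pos_of_not_collinear hc2
  have hlaw : Real.sin (∠ X A B) * dist A B = Real.sin (∠ A X B) * dist X B := by
    have := EuclideanGeometry.sin_angle_mul_dist_eq_sin_angle_mul_dist X A B
    rw [angle_comm B X A, dist_comm B X] at this
    exact this
  have hsum := EuclideanGeometry.angle_add_angle_add_angle_eq_pi B hXA
  have hB := EuclideanGeometry.angle_nonneg X B A
  have hlt : 2 * Real.sin (∠ X A B) < Real.sin (∠ A X B) := by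
    by_contra! hcon
    nlinarith
  have ha0 := EuclideanGeometry.angle_nonneg X A B
  have hx0 := EuclideanGeometry.angle_nonneg A X B
  have hxpi := EuclideanGeometry.angle_le_pi A X B
  have hord : ∠ X A B < ∠ A X B := by
    have hc3 : ¬ Collinear ℝ ({B, X, A} : Set E2) := by
      have : ({B, X, A} : Set E2) = {A, B, X} := by ext; simp; tauto
      rwa [this]
    have := (EuclideanGeometry.angle_lt_iff_dist_lt hc3).2 (by rw [dist_comm B A, dist_comm B X]; linarith)
    rwa [angle_comm B A X, angle_comm B X A] at this
  by_contra! hcon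
  have hm : Real.sin (∠ A X B / 2) ≤ Real.sin (∠ X A B) :=
    Real.sin_le_sin_of_le_of_le_pi_div_two (by linarith [Real.pi_pos])
      (by linarith [angle_comm X A B, angle_comm X B A, angle_comm A X B, angle_nonneg A B X]) hcon
  have hd : Real.sin (∠ A X B) = 2 * Real.sin (∠ A X B / 2) * Real.cos (∠ A X B / 2) := by
    rw [← Real.sin_two_mul]; congr 1; ring
  have h1 := Real.cos_le_one (∠ A X B / 2)
  have h2 : 0 ≤ Real.sin (∠ A X B / 2) :=
    Real.sin_nonneg_of_nonneg_of_le_pi (by linarith) (by linarith)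
  nlinarith
end
end
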